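/- Let n ≥ 2, p < 1, and 0 < τ1 < τ2. Suppose f : S^{n-1} → ℝ satisfies τ1 < f(u) < τ2 for all u ∈ S^{n-1}, and K ∈ K_0^n is a solution of the L_p Minkowski problem dS_{K,p} = f dH^{n-1}. Then the set X_0 = {x ∈ ∂K : N(K,x) ⊆ N(K,o)} is closed in ℝ^n, every point of X = ∂K \ X_0 is a smooth point of K, and X contains no nondegenerate segment (there are no distinct points x, y with the closed segment [x,y] contained in X). -/

import Mathlib

open MeasureTheory Set
open scoped ENNReal NNReal RealInnerProductSpace

noncomputable section

/-- Support function of a set `K`. -/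
def suppFn {n : ℕ} (K : Set (EuclideanSpace ℝ (Fin n))) (u : EuclideanSpace ℝ (Fin n)) : ℝ :=
  sSup ((fun y => ⟪u, y⟫) '' K)

/-- Face of `K` with outer normal `u`. -/
def face {n : ℕ} (K : Set (EuclideanSpace ℝ (Fin n))) (u : EuclideanSpace ℝ (Fin n)) :
    Set (EuclideanSpace ℝ (Fin n)) :=
  {z ∈ K | ⟪z, u⟫ = suppFn K u}

/-- Normal cone of `K` at `z`. -/
def normalCone {n : ℕ} (K : Set (EuclideanSpace ℝ (Fin n))) (z : EuclideanSpace ℝ (Fin n)) :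
    Set (EuclideanSpace ℝ (Fin n)) :=
  {u | ∀ y ∈ K, ⟪u, y⟫ ≤ ⟪u, z⟫}

/-- The unit sphere `S^{n-1}` in `ℝ^n`. -/
def unitSphere (n : ℕ) : Set (EuclideanSpace ℝ (Fin n)) :=
  Metric.sphere (0 : EuclideanSpace ℝ (Fin n)) 1

/-- Surface area measure of `K` evaluated on `ω`:
`S_K(ω) = H^{n-1}(⋃_{u ∈ ω} F(K,u))`. -/
def surfMeas {n : ℕ} (K : Set (EuclideanSpace ℝ (Fin n)))
    (ω : Set (EuclideanSpace ℝ (Fin n))) : ℝ≥0∞ :=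
  μH[(n : ℝ) - 1] (⋃ u ∈ ω, face K u)

/-- `K ∈ 𝒦₀ⁿ`: compact convex with nonempty interior, containing the origin. -/
def IsConvexBody0 {n : ℕ} (K : Set (EuclideanSpace ℝ (Fin n))) : Prop :=
  IsCompact K ∧ Convex ℝ K ∧ (interior K).Nonempty ∧ (0 : EuclideanSpace ℝ (Fin n)) ∈ K

/-- `K` is a solution of the `L_p` Minkowski problem `dS_{K,p} = f dH^{n-1}`. -/
def IsLpSolution {n : ℕ} (p : ℝ) (f : EuclideanSpace ℝ (Fin n) → ℝ)
    (K : Set (EuclideanSpace ℝ (Fin n))) : Prop :=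
  μH[(n : ℝ) - 1] {u ∈ unitSphere n | suppFn K u = 0} = 0 ∧
  ∀ ω : Set (EuclideanSpace ℝ (Fin n)), MeasurableSet ω →
    ω ⊆ {u ∈ unitSphere n | 0 < suppFn K u} →
    surfMeas K ω
      = ∫⁻ u in ω, ENNReal.ofReal ((n : ℝ) * f u * suppFn K u ^ (p - 1)) ∂μH[(n : ℝ) - 1]

/-- `x` is a smooth boundary point: the normal cone spans a one-dimensional space. -/
def IsSmoothPt {n : ℕ} (K : Set (EuclideanSpace ℝ (Fin n)))
    (x : EuclideanSpace ℝ (Fin n)) : Prop :=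
  Module.finrank ℝ (Submodule.span ℝ (normalCone K x)) = 1

/-- `K` is smooth: every boundary point is a smooth point. -/
def IsSmoothBody {n : ℕ} (K : Set (EuclideanSpace ℝ (Fin n))) : Prop :=
  ∀ x ∈ frontier K, IsSmoothPt K x

/-- Subgradient of `v` at `x` relative to the domain `Ω`. -/
def subgrad {n : ℕ} (Ω : Set (EuclideanSpace ℝ (Fin n))) (v : EuclideanSpace ℝ (Fin n) → ℝ)
    (x : EuclideanSpace ℝ (Fin n)) : Set (EuclideanSpace ℝ (Fin n)) :=
  {z | ∀ y ∈ Ω, v x + ⟪z, y - x⟫ ≤ v y}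

/-- Monge–Ampère measure of `v` (relative to domain `Ω`) evaluated on `ω`. -/
def maMeasure {n : ℕ} (Ω : Set (EuclideanSpace ℝ (Fin n))) (v : EuclideanSpace ℝ (Fin n) → ℝ)
    (ω : Set (EuclideanSpace ℝ (Fin n))) : ℝ≥0∞ :=
  μH[(n : ℝ)] (⋃ x ∈ ω, subgrad Ω v x)

/-- Hessian matrix of `v : ℝ^n → ℝ` at `x`. -/
def hessMatrix {n : ℕ} (v : EuclideanSpace ℝ (Fin n) → ℝ) (x : EuclideanSpace ℝ (Fin n)) :
    Matrix (Fin n) (Fin n) ℝ :=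
  Matrix.of fun i j =>
    fderiv ℝ (fun y => fderiv ℝ v y (EuclideanSpace.single j 1)) x (EuclideanSpace.single i 1)

section Geo
open scoped Pointwise
variable {G : Type*} [NormedAddCommGroup G] [InnerProductSpace ℝ G] [FiniteDimensional ℝ G]

lemma exists_asym {S : Set G} (hS : IsCompact S) (hc : Convex ℝ S) (hne : S.Nonempty) :
    ∃ s ∈ S, ∀ x ∈ S, ∃ y ∈ S, ((Module.finrank ℝ G : ℝ) + 1 + 1) • s
      = ((Module.finrank ℝ G : ℝ) + 1) • y + x := by
  set k : ℝ := (Module.finrank ℝ G : ℝ) + 1 with hk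
  have hk1 : 1 ≤ k := by rw [hk]; have : (0:ℝ) ≤ Module.finrank ℝ G := by positivity
                         linarith
  have hk0 : 0 < k := by linarith
  let F : S → Set G := fun x => (AffineMap.homothety (x : G) (k / (k + 1))) '' S
  have h := Convex.helly_theorem_compact' (𝕜 := ℝ) (F := F)
    (fun i => hc.affine_image _)
    (fun i => hS.image (AffineMap.homothety_continuous _ _)) (by
      intro I hI
      rcases I.eq_empty_or_nonempty with rfl | hIne
      · simp
      · set j : ℝ := (I.card : ℝ) with hj
        have hj0 : 0 < j := by rw [hj]; exact_mod_cast hIne.card_pos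
        have hjk : j ≤ k := by rw [hj, hk]; exact_mod_cast hI
        refine ⟨j⁻¹ • ∑ i ∈ I, (i : G), ?_⟩
        simp only [mem_iInter]
        intro i hi
        classical
        refine ⟨∑ l ∈ I, (((k + 1) / j - if l = i then 1 else 0) / k) • (l : G), ?_, ?_⟩
        · apply hc.sum_mem
          · intro l hl
            have : 1 ≤ (k + 1) / j := by rw [le_div_iff₀ hj0]; linarith
            apply div_nonneg _ hk0.le
            split_ifs <;> linarith
          · rw [← Finset.sum_div, Finset.sum_sub_distrib]
            simp only [Finset.sum_const, nsmul_eq_mul, Finset.sum_ite_eq', hi, if_true]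
            rw [← hj]; field_simp; ring
          · intro l hl; exact l.2
        · rw [AffineMap.homothety_apply]
          simp only [vsub_eq_sub, vadd_eq_add]
          have : ∑ l ∈ I, (((k + 1) / j - if l = i then 1 else 0) / k) • (l : G)
             = ((k+1)/j/k) • ∑ l ∈ I, (l:G) - (1/k) • (i:G) := by
            simp only [sub_div, sub_smul, Finset.sum_sub_distrib, ← Finset.smul_sum]
            congr 1
            simp [ite_div, ite_smul, hi]
          rw [this]
          match_scalars <;> field_simp <;> ring)
  obtain ⟨s, hs⟩ := h
  simp only [mem_iInter] at hs
  have key : ∀ x ∈ S, ∃ y ∈ S, (k + 1) • s = k • y + x := by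
    intro x hx
    obtain ⟨y, hy, hys⟩ := hs ⟨x, hx⟩
    refine ⟨y, hy, ?_⟩
    rw [← hys, AffineMap.homothety_apply]
    simp only [vsub_eq_sub, vadd_eq_add]
    match_scalars <;> field_simp <;> ring
  refine ⟨s, ?_, key⟩
  obtain ⟨x, hx⟩ := hne
  obtain ⟨y, hy, h⟩ := key x hx
  have : s = (k / (k+1)) • y + (1/(k+1)) • x := by
    have : s = (k+1)⁻¹ • ((k+1) • s) := by rw [smul_smul, inv_mul_cancel₀ (by positivity), one_smul]
    rw [this, h]
    match_scalars <;> field_simp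
  rw [this]
  exact hc hy hx (by positivity) (by positivity) (by field_simp)

/-- polar of `S` with respect to `s` -/
def pol (S : Set G) (s : G) : Set G := {z | ∀ q ∈ S, ⟪z, q - s⟫ ≤ 1}

lemma pol_closed (S : Set G) (s : G) : IsClosed (pol S s) := by
  have : pol S s = ⋂ q ∈ S, {z | ⟪z, q - s⟫ ≤ 1} := by ext; simp [pol]
  rw [this]
  exact isClosed_biInter fun q _ => isClosed_le (by fun_prop) continuous_const

variable [MeasurableSpace G] [BorelSpace G] (μ : Measure G) [μ.IsAddHaarMeasure]

lemma geo_main {S : Set G} (hS : IsCompact S) (hc : Convex ℝ S) (h0 : (0:G) ∈ interior S)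
    (N : ℕ) (hN : 0 < N) {d q1 : G} {η δ : ℝ} (hη : 0 < η) (hd : ∀ q ∈ S, ⟪d, q⟫ ≤ η)
    (hq1 : q1 ∈ S) (hdq : ⟪d, q1⟫ ≤ -δ)
    (hδ : (4 * N * ((Module.finrank ℝ G : ℝ) + 2) + (Module.finrank ℝ G + 1)) * η < δ) :
    ∃ s ∈ S, μ (pol S s) ≠ 0 ∧ μ (pol S s) ≠ ∞ ∧
      N * (ENNReal.ofReal ((1 / (2 * ((Module.finrank ℝ G : ℝ) + 2))) ^ Module.finrank ℝ G)
        * μ (pol S s)) ≤ μ (pol S 0) := by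
  have h0S : (0:G) ∈ S := interior_subset h0
  obtain ⟨s, hsS, hs⟩ := exists_asym hS hc ⟨0, h0S⟩
  set m : ℕ := Module.finrank ℝ G with hm
  set k : ℝ := (m : ℝ) + 1 with hk
  have hk1 : 1 ≤ k := by rw [hk]; have : (0:ℝ) ≤ m := by positivity
                         linarith
  have hk0 : 0 < k := by linarith
  have hk2 : (m:ℝ) + 2 = k + 1 := by rw [hk]; ring
  rw [hk2] at hδ ⊢
  have hN0 : (0:ℝ) < N := by exact_mod_cast hN
  -- bounds on P
  have hP1 : ∀ z ∈ pol S s, -1 ≤ ⟪z, s⟫ := by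
    intro z hz; have := hz 0 h0S; simp at this; linarith
  have hP2 : ∀ z ∈ pol S s, ⟪z, s⟫ ≤ k := by
    intro z hz
    obtain ⟨y, hy, h⟩ := hs 0 h0S
    have h1 := hz y hy
    have h2 := congrArg (fun t => ⟪z, t⟫) h
    simp only [add_zero, inner_smul_right] at h2
    rw [inner_sub_right] at h1
    nlinarith
  have hD : (k + 1) * ⟪d, s⟫ ≤ k * η - δ := by
    obtain ⟨y, hy, h⟩ := hs q1 hq1
    have h2 := congrArg (fun t => ⟪d, t⟫) h
    simp only [inner_add_right, inner_smul_right] at h2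
    have := hd y hy
    nlinarith
  have hD' : ⟪d, s⟫ < - (4 * N * η) := by
    by_contra hcon
    push Not at hcon
    nlinarith
  have hPS : ∀ z ∈ pol S s, ∀ q ∈ S, ⟪z, q⟫ ≤ k + 1 := by
    intro z hz q hq
    have h1 := hz q hq
    have h2 := hP2 z hz
    rw [inner_sub_right] at h1; linarith
  obtain ⟨r, hr, hball⟩ := Metric.isOpen_iff.1 isOpen_interior 0 h0
  have hPb : pol S s ⊆ Metric.closedBall 0 ((k + 1) * 2 / r) := by
    intro z hz
    rw [mem_closedBall_zero_iff]
    rcases eq_or_ne z 0 with rfl | hz0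
    · simp; positivity
    have hzn : 0 < ‖z‖ := norm_pos_iff.2 hz0
    have hq : (r / 2 / ‖z‖) • z ∈ S := by
      apply interior_subset; apply hball
      rw [mem_ball_zero_iff, norm_smul, Real.norm_of_nonneg (by positivity)]
      field_simp; linarith
    have := hPS z hz _ hq
    rw [inner_smul_right, real_inner_self_eq_norm_sq] at this
    rw [le_div_iff₀ hr]
    have e : r / 2 / ‖z‖ * ‖z‖ ^ 2 = r * ‖z‖ / 2 := by field_simp
    rw [e] at this; linarith
  refine ⟨s, hsS, ?_, ?_, ?_⟩
  · obtain ⟨R, hR⟩ := hS.isBounded.exists_norm_le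
    have hR0 : 0 ≤ R := le_trans (norm_nonneg _) (hR 0 h0S)
    have : Metric.ball (0:G) (1 / (R + ‖s‖ + 1)) ⊆ pol S s := by
      intro z hz q hq
      rw [mem_ball_zero_iff, lt_div_iff₀ (by positivity)] at hz
      calc ⟪z, q - s⟫ ≤ ‖z‖ * ‖q - s‖ := real_inner_le_norm _ _
        _ ≤ ‖z‖ * (R + ‖s‖ + 1) := by
          gcongr
          have := norm_sub_le q s
          have := hR q hq
          linarith
        _ ≤ 1 := hz.le
    have h2 : 0 < μ (Metric.ball (0:G) (1 / (R + ‖s‖ + 1))) :=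
      Metric.measure_ball_pos _ _ (by positivity)
    exact (h2.trans_le (measure_mono this)).ne'
  · exact ((measure_mono hPb).trans_lt (isCompact_closedBall _ _).measure_lt_top).ne
  · let t : ℕ → ℝ := fun j => j / (2 * N)
    let c : ℕ → ℝ := fun j => (1 - t j) / (k + 1)
    let Q : ℕ → Set G := fun j => ((t j / η) • d) +ᵥ (c j • pol S s)
    have ht : ∀ j ∈ Finset.range N, 0 ≤ t j ∧ t j ≤ 1/2 := by
      intro j hj
      have : (j:ℝ) ≤ N := by exact_mod_cast (Finset.mem_range.1 hj).le
      constructor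
      · simp only [t]; positivity
      · simp only [t]; rw [div_le_div_iff₀ (by positivity) (by norm_num)]; linarith
    have hmem : ∀ j z, z ∈ Q j → ∃ p ∈ pol S s, z = (t j / η) • d + c j • p := by
      intro j z hz
      obtain ⟨w, ⟨p, hp, rfl⟩, rfl⟩ := hz
      exact ⟨p, hp, rfl⟩
    have hsub : ∀ j ∈ Finset.range N, Q j ⊆ pol S 0 := by
      intro j hj z hz q hq
      obtain ⟨p, hp, rfl⟩ := hmem j z hz
      obtain ⟨ht0, ht1⟩ := ht j hj
      have h1 := hPS p hp q hq
      have h2 := hd q hq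
      rw [sub_zero, inner_add_left, real_inner_smul_left, real_inner_smul_left]
      have e1 : t j / η * ⟪d, q⟫ ≤ t j := by
        rw [div_mul_eq_mul_div, div_le_iff₀ hη]; gcongr
      have e2 : c j * ⟪p, q⟫ ≤ 1 - t j := by
        simp only [c]; rw [div_mul_eq_mul_div, div_le_iff₀ (by positivity)]
        gcongr; linarith
      linarith
    have hmeas : ∀ j, MeasurableSet (Q j) := by
      intro j
      rcases eq_or_ne (c j) 0 with hcj | hcj
      · have : IsCompact (pol S s) := (isCompact_closedBall _ _).of_isClosed_subset
          (pol_closed S s) hPb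
        exact ((this.smul (c j)).vadd _).isClosed.measurableSet
      · exact (((pol_closed S s).smul_of_ne_zero hcj).vadd _).measurableSet
    have hdisj : ∀ i ∈ Finset.range N, ∀ j ∈ Finset.range N, i < j → Disjoint (Q i) (Q j) := by
      intro i hi j hj hij
      rw [Set.disjoint_left]
      intro z hz hz'
      obtain ⟨p, hp, rfl⟩ := hmem i z hz
      obtain ⟨p', hp', he⟩ := hmem j _ hz'
      obtain ⟨hti, hti1⟩ := ht i hi
      obtain ⟨htj, htj1⟩ := ht j hj
      have h2 := congrArg (fun t => ⟪t, s⟫) he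
      simp only [inner_add_left, real_inner_smul_left] at h2
      have a1 : -1 ≤ c i * ⟪p, s⟫ := by
        have := hP1 p hp
        simp only [c]; rw [div_mul_eq_mul_div, le_div_iff₀ (by positivity)]
        nlinarith
      have a2 : c j * ⟪p', s⟫ ≤ 1 := by
        have := hP2 p' hp'
        simp only [c]; rw [div_mul_eq_mul_div, div_le_iff₀ (by positivity)]
        nlinarith
      have a3 : 1 / (2 * N) ≤ t j - t i := by
        simp only [t]; rw [← sub_div]
        gcongr
        have : (i:ℝ) + 1 ≤ j := by exact_mod_cast hij
        linarith
      have a4 : (t j - t i) * (-⟪d, s⟫ / η) ≤ 2 := by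
        have : (t j - t i) * (-⟪d, s⟫ / η) = c j * ⟪p', s⟫ - c i * ⟪p, s⟫ := by
          have : t i / η * ⟪d, s⟫ - t j / η * ⟪d, s⟫ = (t j - t i) * (-⟪d, s⟫ / η) := by ring
          linarith
        linarith
      have a5 : 4 * N < -⟪d, s⟫ / η := by
        rw [lt_div_iff₀ hη]; linarith
      have a6 : 1 / (2 * N) * (4 * N : ℝ) < (t j - t i) * (-⟪d, s⟫ / η) := by
        apply mul_lt_mul' a3 a5 (by positivity)
        exact lt_of_lt_of_le (by positivity) a3
      have a7 : 1 / (2 * N) * (4 * N : ℝ) = 2 := by field_simp; norm_num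
      linarith
    have hpd : (↑(Finset.range N) : Set ℕ).PairwiseDisjoint Q := by
      intro i hi j hj hij
      rcases lt_or_gt_of_ne hij with h | h
      · exact hdisj i hi j hj h
      · exact (hdisj j hj i hi h).symm
    calc (N:ℝ≥0∞) * (ENNReal.ofReal ((1 / (2 * (k + 1))) ^ m) * μ (pol S s))
        = ∑ j ∈ Finset.range N, ENNReal.ofReal ((1 / (2 * (k + 1))) ^ m) * μ (pol S s) := by simp
      _ ≤ ∑ j ∈ Finset.range N, μ (Q j) := by
          apply Finset.sum_le_sum
          intro j hj
          obtain ⟨ht0, ht1⟩ := ht j hj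
          simp only [Q]
          rw [measure_vadd, Measure.addHaar_smul]
          gcongr
          rw [← hm, abs_of_nonneg (by simp only [c]; apply pow_nonneg; apply div_nonneg <;> linarith)]
          gcongr
          simp only [c]
          rw [div_le_div_iff₀ (by positivity) (by positivity)]
          nlinarith
      _ = μ (⋃ j ∈ Finset.range N, Q j) := (measure_biUnion_finset hpd fun j _ => hmeas j).symm
      _ ≤ μ (pol S 0) := measure_mono (iUnion₂_subset hsub)

end Geo

section Basics
variable {n : ℕ} {K : Set (EuclideanSpace ℝ (Fin n))}

lemma supp_le (hK : IsCompact K) (u : EuclideanSpace ℝ (Fin n)) {y : EuclideanSpace ℝ (Fin n)}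
    (hy : y ∈ K) : ⟪u, y⟫ ≤ suppFn K u :=
  le_csSup (hK.image (by fun_prop)).bddAbove ⟨y, hy, rfl⟩

lemma supp_exists (hK : IsCompact K) (hne : K.Nonempty) (u : EuclideanSpace ℝ (Fin n)) :
    ∃ y ∈ K, ⟪u, y⟫ = suppFn K u := by
  obtain ⟨y, hy, h⟩ := (hK.image (f := fun y => ⟪u, y⟫) (by fun_prop)).sSup_mem (hne.image _)
  exact ⟨y, hy, h⟩

lemma supp_comb (hK : IsCompact K) (hne : K.Nonempty) (u v : EuclideanSpace ℝ (Fin n)) {a b : ℝ}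
    (ha : 0 ≤ a) (hb : 0 ≤ b) :
    suppFn K (a • u + b • v) ≤ a * suppFn K u + b * suppFn K v := by
  obtain ⟨y, hy, h⟩ := supp_exists hK hne (a • u + b • v)
  rw [← h, inner_add_left, real_inner_smul_left, real_inner_smul_left]
  have := supp_le hK u hy
  have := supp_le hK v hy
  gcongr

lemma supp_cont (hK : IsCompact K) (hne : K.Nonempty) : Continuous (suppFn K) := by
  obtain ⟨R, hR⟩ := hK.isBounded.exists_norm_le
  apply LipschitzWith.continuous (K := R.toNNReal)
  apply LipschitzWith.of_le_add_mul
  intro u v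
  obtain ⟨y, hy, h⟩ := supp_exists hK hne u
  have h1 := supp_le hK v hy
  have h2 : ⟪u - v, y⟫ ≤ ‖u - v‖ * ‖y‖ := real_inner_le_norm _ _
  have h3 := hR y hy
  have h4 : R ≤ (R.toNNReal : ℝ) := by simp
  rw [inner_sub_left] at h2
  rw [dist_eq_norm]
  nlinarith [norm_nonneg (u - v)]

lemma supp_smul (hK : IsCompact K) (hne : K.Nonempty) (u : EuclideanSpace ℝ (Fin n)) {t : ℝ}
    (ht : 0 ≤ t) : suppFn K (t • u) = t * suppFn K u := by
  apply le_antisymm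
  · have := supp_comb hK hne u u ht le_rfl
    simpa using this
  · obtain ⟨y, hy, h⟩ := supp_exists hK hne u
    rw [← h, ← real_inner_smul_left]
    exact supp_le hK _ hy

lemma face_smul (hK : IsCompact K) (hne : K.Nonempty) (u : EuclideanSpace ℝ (Fin n)) {t : ℝ}
    (ht : 0 < t) : face K (t • u) = face K u := by
  ext z
  simp only [face, mem_ofPred_eq, inner_smul_right, supp_smul hK hne u ht.le]
  rw [mul_right_inj' ht.ne']

end Basics

section MeasHelp
variable {X Y : Type*} [MetricSpace X] [MetricSpace Y] [MeasurableSpace X] [BorelSpace X]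
  [MeasurableSpace Y] [BorelSpace Y]

lemma hausdorff_antilip {s : Set X} {g : X → Y} {C : ℝ≥0} {d : ℝ} (hd : 0 ≤ d)
    (h : ∀ x ∈ s, ∀ y ∈ s, dist x y ≤ C * dist (g x) (g y)) :
    μH[d] s ≤ (C : ℝ≥0∞) ^ d * μH[d] (g '' s) := by
  have h1 : AntilipschitzWith C (fun x : s => g x) :=
    AntilipschitzWith.of_le_mul_dist fun x y => h x x.2 y y.2
  have h2 := h1.le_hausdorffMeasure_image hd univ
  have h3 := (isometry_subtype_coe (s := s)).hausdorffMeasure_image (d := d) (Or.inl hd) univ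
  rw [← h3] at h2
  convert h2 using 3
  · simp
  · ext; simp

lemma hausdorff_lip {s : Set X} {g : X → Y} {C : ℝ≥0} {d : ℝ} (hd : 0 ≤ d)
    (h : ∀ x ∈ s, ∀ y ∈ s, dist (g x) (g y) ≤ C * dist x y) :
    μH[d] (g '' s) ≤ (C : ℝ≥0∞) ^ d * μH[d] s :=
  (LipschitzOnWith.of_dist_le_mul h).hausdorffMeasure_image_le hd

end MeasHelp

/-- An affine chart of the sphere of directions. -/
structure Chart (n : ℕ) (G : Type*) [NormedAddCommGroup G] [InnerProductSpace ℝ G] where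
  ι : G →ₗᵢ[ℝ] EuclideanSpace ℝ (Fin n)
  π : EuclideanSpace ℝ (Fin n) →L[ℝ] G
  e : EuclideanSpace ℝ (Fin n)
  u0 : EuclideanSpace ℝ (Fin n)
  he : ‖e‖ = 1
  hu0 : ⟪u0, e⟫ = 1
  hιe : ∀ g, ⟪ι g, e⟫ = 0
  hπ : ∀ y g, ⟪π y, g⟫ = ⟪y, ι g⟫
  hdec : ∀ y, y = ι (π y) + ⟪y, e⟫ • e

namespace Chart
variable {n : ℕ} {G : Type*} [NormedAddCommGroup G] [InnerProductSpace ℝ G] (c : Chart n G)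

/-- the direction with parameter `q` -/
def U (q : G) : EuclideanSpace ℝ (Fin n) := c.u0 + c.ι q

/-- union of the faces with directions in `T` -/
def FF (K : Set (EuclideanSpace ℝ (Fin n))) (T : Set G) : Set (EuclideanSpace ℝ (Fin n)) :=
  ⋃ q ∈ T, face K (c.U q)

lemma U_e (q : G) : ⟪c.U q, c.e⟫ = 1 := by
  simp [U, inner_add_left, c.hu0, c.hιe]

lemma U_cont : Continuous c.U := by
  unfold U; exact continuous_const.add c.ι.continuous

lemma U_sub (q q' : G) : c.U q - c.U q' = c.ι (q - q') := by simp [U]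

lemma one_le (q : G) : 1 ≤ ‖c.U q‖ := by
  have := real_inner_le_norm (c.U q) c.e
  rwa [c.U_e, c.he, mul_one] at this

lemma U_le {q : G} {ρ : ℝ} (hq : q ∈ Metric.closedBall (0:G) ρ) : ‖c.U q‖ ≤ ‖c.u0‖ + ρ := by
  have := norm_add_le c.u0 (c.ι q)
  rw [c.ι.norm_map] at this
  rw [mem_closedBall_zero_iff] at hq
  unfold U; linarith

lemma π_le (y : EuclideanSpace ℝ (Fin n)) : ‖c.π y‖ ≤ ‖y‖ := by
  have h := c.hπ y (c.π y)
  rw [real_inner_self_eq_norm_sq] at h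
  have h2 := real_inner_le_norm y (c.ι (c.π y))
  rw [c.ι.norm_map] at h2
  by_contra hc
  push Not at hc
  have : 0 < ‖c.π y‖ := lt_of_le_of_lt (norm_nonneg _) hc
  nlinarith

lemma inner_U (q : G) (y : EuclideanSpace ℝ (Fin n)) :
    ⟪c.U q, y⟫ = ⟪c.u0, y⟫ + ⟪c.π y, q⟫ := by
  rw [c.hπ, U, inner_add_left, real_inner_comm (c.ι q) y]

/-- normalized direction -/
def φ (q : G) : EuclideanSpace ℝ (Fin n) := ‖c.U q‖⁻¹ • c.U q

lemma φ_norm (q : G) : ‖c.φ q‖ = 1 := by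
  have := c.one_le q
  rw [φ, norm_smul, norm_inv, norm_norm, inv_mul_cancel₀ (by linarith)]

lemma φ_cont : Continuous c.φ := by
  unfold φ
  exact (c.U_cont.norm.inv₀ (fun q => by have := c.one_le q; linarith)).smul c.U_cont

lemma φ_lip (q q' : G) : ‖c.φ q - c.φ q'‖ ≤ 2 * ‖q - q'‖ := by
  have h1 := c.one_le q
  have h2 := c.one_le q'
  have e : c.φ q - c.φ q' = ‖c.U q‖⁻¹ • (c.U q - c.U q')
      + (‖c.U q‖⁻¹ * (‖c.U q'‖ - ‖c.U q‖)) • c.φ q' := by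
    unfold φ
    match_scalars
    · field_simp
    · field_simp; ring
  rw [e]
  have h3 : ‖c.U q - c.U q'‖ = ‖q - q'‖ := by rw [U_sub, c.ι.norm_map]
  have h4 : |‖c.U q'‖ - ‖c.U q‖| ≤ ‖q - q'‖ := by
    rw [← h3, norm_sub_rev]; exact abs_norm_sub_norm_le _ _
  have h5 : ‖c.U q‖⁻¹ ≤ 1 := inv_le_one_of_one_le₀ h1
  have h6 : 0 ≤ ‖c.U q‖⁻¹ := by positivity
  calc _ ≤ _ := norm_add_le _ _
    _ = ‖c.U q‖⁻¹ * ‖q - q'‖ + ‖c.U q‖⁻¹ * |‖c.U q'‖ - ‖c.U q‖| := by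
      rw [norm_smul, norm_smul, φ_norm, h3, norm_mul, Real.norm_of_nonneg h6, Real.norm_eq_abs,
        mul_one]
    _ ≤ 1 * ‖q - q'‖ + 1 * ‖q - q'‖ := by gcongr
    _ = _ := by ring

lemma φ_antilip {q q' : G} {R : ℝ} (hq : ‖c.U q‖ ≤ R) (hq' : ‖c.U q'‖ ≤ R) :
    ‖q - q'‖ ≤ (2 * R ^ 2) * ‖c.φ q - c.φ q'‖ := by
  have h1 := c.one_le q
  have h2 := c.one_le q'
  have h3 : ‖c.U q - c.U q'‖ = ‖q - q'‖ := by rw [U_sub, c.ι.norm_map]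
  have ha : ‖c.U q‖⁻¹ - ‖c.U q'‖⁻¹ = ⟪c.φ q - c.φ q', c.e⟫ := by
    rw [inner_sub_left, φ, φ, real_inner_smul_left, real_inner_smul_left, U_e, U_e]; ring
  have ha' : |‖c.U q‖⁻¹ - ‖c.U q'‖⁻¹| ≤ ‖c.φ q - c.φ q'‖ := by
    rw [ha]
    have := abs_real_inner_le_norm (c.φ q - c.φ q') c.e
    rwa [c.he, mul_one] at this
  have e : c.U q - c.U q' = ‖c.U q‖ • (c.φ q - c.φ q')
      + (‖c.U q‖ * ‖c.U q'‖ * (‖c.U q'‖⁻¹ - ‖c.U q‖⁻¹)) • c.φ q' := by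
    unfold φ
    match_scalars
    · field_simp
    · field_simp; ring
  rw [← h3, e]
  have hR : 1 ≤ R := h1.trans hq
  calc _ ≤ _ := norm_add_le _ _
    _ = ‖c.U q‖ * ‖c.φ q - c.φ q'‖ + ‖c.U q‖ * ‖c.U q'‖ * |‖c.U q‖⁻¹ - ‖c.U q'‖⁻¹| := by
      rw [norm_smul, norm_smul, φ_norm, norm_mul, norm_mul, norm_norm, norm_norm, Real.norm_eq_abs,
        mul_one, abs_sub_comm]
    _ ≤ R * ‖c.φ q - c.φ q'‖ + R * R * ‖c.φ q - c.φ q'‖ := by gcongr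
    _ ≤ R * R * ‖c.φ q - c.φ q'‖ + R * R * ‖c.φ q - c.φ q'‖ := by gcongr; nlinarith
    _ = _ := by ring

lemma FF_antilip {K : Set (EuclideanSpace ℝ (Fin n))} (hK : IsCompact K) {ρ : ℝ} {T : Set G}
    (hT : T ⊆ Metric.closedBall 0 ρ) (x : EuclideanSpace ℝ (Fin n)) (hx : x ∈ c.FF K T)
    (y : EuclideanSpace ℝ (Fin n)) (hy : y ∈ c.FF K T) :
    dist x y ≤ (‖c.u0‖ + ρ + 1) * dist (c.π x) (c.π y) := by
  have key : ∀ x ∈ c.FF K T, ∀ y ∈ c.FF K T,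
      ⟪x - y, c.e⟫ ≤ (‖c.u0‖ + ρ) * ‖c.π (x - y)‖ := by
    intro x hx y hy
    simp only [FF, mem_iUnion] at hx hy
    obtain ⟨q, hq, hxK, hxq⟩ := hx
    obtain ⟨q', hq', hyK, hyq⟩ := hy
    have h1 := supp_le hK (c.U q') hxK
    rw [← hyq, real_inner_comm, ← sub_nonpos, ← inner_sub_left] at h1
    have h2 := c.hdec (x - y)
    rw [h2, inner_add_left, real_inner_smul_left, real_inner_comm _ c.e, c.U_e, mul_one] at h1
    have h3 : -⟪c.ι (c.π (x - y)), c.U q'⟫ ≤ ‖c.ι (c.π (x - y))‖ * ‖c.U q'‖ :=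
      (neg_le_abs _).trans (abs_real_inner_le_norm _ _)
    rw [c.ι.norm_map] at h3
    have h4 := c.U_le (hT hq')
    nlinarith [norm_nonneg (c.π (x - y))]
  have h1 := key x hx y hy
  have h2 := key y hy x hx
  rw [← neg_sub x y, inner_neg_left, map_neg, norm_neg] at h2
  rw [dist_eq_norm, dist_eq_norm, ← map_sub]
  have h3 := c.hdec (x - y)
  calc ‖x - y‖ = ‖c.ι (c.π (x - y)) + ⟪x - y, c.e⟫ • c.e‖ := by rw [← h3]
    _ ≤ ‖c.ι (c.π (x - y))‖ + ‖⟪x - y, c.e⟫ • c.e‖ := norm_add_le _ _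
    _ = ‖c.π (x - y)‖ + |⟪x - y, c.e⟫| := by
      rw [norm_smul, c.he, c.ι.norm_map, mul_one, Real.norm_eq_abs]
    _ ≤ ‖c.π (x - y)‖ + (‖c.u0‖ + ρ) * ‖c.π (x - y)‖ := by
      gcongr; exact abs_le.2 ⟨by linarith, h1⟩
    _ = _ := by ring

variable [FiniteDimensional ℝ G] [MeasurableSpace G] [BorelSpace G]

theorem meas_cmp (hn : 2 ≤ n) {p : ℝ} {τ1 τ2 : ℝ}
    (hτ1 : 0 < τ1) (hτ12 : τ1 < τ2) {f : EuclideanSpace ℝ (Fin n) → ℝ}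
    (hf : ∀ u ∈ unitSphere n, τ1 < f u ∧ f u < τ2)
    {K : Set (EuclideanSpace ℝ (Fin n))} (hK : IsConvexBody0 K)
    (hsol : IsLpSolution p f K) {ρ : ℝ} (hρ : 0 < ρ)
    (hpos : ∀ q ∈ Metric.closedBall (0:G) ρ, 0 < suppFn K (c.U q)) :
    ∃ C : ℝ≥0∞, C ≠ ∞ ∧ ∀ T : Set G, IsCompact T → T ⊆ Metric.closedBall 0 ρ →
      μH[(n:ℝ) - 1] (c.π '' c.FF K T) ≤ C * μH[(n:ℝ) - 1] T ∧
      μH[(n:ℝ) - 1] T ≤ C * μH[(n:ℝ) - 1] (c.π '' c.FF K T) := by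
  obtain ⟨hKc, hKconv, hKint, h0K⟩ := hK
  have hne : K.Nonempty := ⟨0, h0K⟩
  have hn1 : (2:ℝ) ≤ n := by exact_mod_cast hn
  have hd : 0 ≤ (n:ℝ) - 1 := by linarith
  have hφpos : ∀ q ∈ Metric.closedBall (0:G) ρ, 0 < suppFn K (c.φ q) := by
    intro q hq
    have := c.one_le q
    rw [φ, supp_smul hKc hne _ (by positivity)]
    exact mul_pos (by positivity) (hpos q hq)
  have hcont : ContinuousOn (fun q => suppFn K (c.φ q) ^ (p - 1)) (Metric.closedBall (0:G) ρ) := by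
    apply ContinuousOn.rpow_const
    · exact ((supp_cont hKc hne).comp c.φ_cont).continuousOn
    · intro q hq; exact Or.inl (hφpos q hq).ne'
  have hbne : (Metric.closedBall (0:G) ρ).Nonempty := ⟨0, by simp [hρ.le]⟩
  obtain ⟨qa, hqa, hmin⟩ := (isCompact_closedBall (0:G) ρ).exists_isMinOn hbne hcont
  obtain ⟨qb, hqb, hmax⟩ := (isCompact_closedBall (0:G) ρ).exists_isMaxOn hbne hcont
  set lo := suppFn K (c.φ qa) ^ (p - 1)
  set hi := suppFn K (c.φ qb) ^ (p - 1)
  have hlo : 0 < lo := Real.rpow_pos_of_pos (hφpos qa hqa) _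
  have hR0 : 0 ≤ ‖c.u0‖ + ρ := by positivity
  set d : ℝ := (n:ℝ) - 1 with hdd
  set A1 : ℝ≥0∞ := ((2:ℝ≥0) : ℝ≥0∞) ^ d
  set A2 : ℝ≥0∞ := ((2 * (‖c.u0‖ + ρ) ^ 2).toNNReal : ℝ≥0∞) ^ d
  set A3 : ℝ≥0∞ := ((1:ℝ≥0) : ℝ≥0∞) ^ d
  set A4 : ℝ≥0∞ := ((‖c.u0‖ + ρ + 1).toNNReal : ℝ≥0∞) ^ d
  set B1 := ENNReal.ofReal (n * τ2 * hi)
  set B2 := ENNReal.ofReal (n * τ1 * lo)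
  have hB2 : B2 ≠ 0 := by
    simp only [B2, ne_eq, ENNReal.ofReal_eq_zero, not_le]; positivity
  have hfin : ∀ a : ℝ≥0, (a : ℝ≥0∞) ^ d ≠ ∞ := fun a =>
    ENNReal.rpow_ne_top_of_nonneg hd ENNReal.coe_ne_top
  refine ⟨A3 * (B1 * A1) + A2 * (B2⁻¹ * A4), ?_, ?_⟩
  · apply ENNReal.add_ne_top.2 ⟨?_, ?_⟩
    · exact ENNReal.mul_ne_top (hfin _) (ENNReal.mul_ne_top ENNReal.ofReal_ne_top (hfin _))
    · exact ENNReal.mul_ne_top (hfin _) (ENNReal.mul_ne_top (ENNReal.inv_ne_top.2 hB2) (hfin _))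
  intro T hT hTb
  have hω : MeasurableSet (c.φ '' T) := (hT.image c.φ_cont).isClosed.measurableSet
  have hFF : c.FF K T = ⋃ u ∈ c.φ '' T, face K u := by
    ext z
    simp only [FF, mem_iUnion, Set.mem_image, exists_prop, exists_exists_and_eq_and]
    have : ∀ q, face K (c.φ q) = face K (c.U q) := fun q => by
      have := c.one_le q
      rw [φ, face_smul hKc hne _ (by positivity)]
    simp only [this]
  have hS : ∀ q, c.φ q ∈ unitSphere n := fun q => by
    rw [unitSphere, mem_sphere_zero_iff_norm]; exact c.φ_norm q
  have hsub : c.φ '' T ⊆ {u ∈ unitSphere n | 0 < suppFn K u} := by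
    rintro _ ⟨q, hq, rfl⟩
    exact ⟨hS q, hφpos q (hTb hq)⟩
  have hs := hsol.2 _ hω hsub
  rw [surfMeas, ← hFF, ← hdd] at hs
  have h1 : μH[d] (c.FF K T) ≤ B1 * μH[d] (c.φ '' T) := by
    rw [hs, ← setLIntegral_const]
    apply setLIntegral_mono' hω
    rintro _ ⟨q, hq, rfl⟩
    apply ENNReal.ofReal_le_ofReal
    have h1 := (hf _ (hS q))
    have h2 : suppFn K (c.φ q) ^ (p - 1) ≤ hi := hmax (hTb hq)
    have h3 := (Real.rpow_pos_of_pos (hφpos q (hTb hq)) (p - 1)).le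
    have h4 : 0 ≤ τ2 := by linarith
    have h5 := h1.2.le
    gcongr
  have h2 : B2 * μH[d] (c.φ '' T) ≤ μH[d] (c.FF K T) := by
    rw [hs, ← setLIntegral_const]
    apply setLIntegral_mono' hω
    rintro _ ⟨q, hq, rfl⟩
    apply ENNReal.ofReal_le_ofReal
    have h1 := (hf _ (hS q))
    have h2 : lo ≤ suppFn K (c.φ q) ^ (p - 1) := hmin (hTb hq)
    have h4 : 0 ≤ f (c.φ q) := by linarith
    have h5 := h1.1.le
    gcongr
  have h3 : μH[d] (c.φ '' T) ≤ A1 * μH[d] T := by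
    apply hausdorff_lip hd
    intro q _ q' _
    rw [dist_eq_norm, dist_eq_norm]
    exact c.φ_lip q q'
  have h4 : μH[d] T ≤ A2 * μH[d] (c.φ '' T) := by
    apply hausdorff_antilip hd
    intro q hq q' hq'
    rw [dist_eq_norm, dist_eq_norm, Real.coe_toNNReal _ (by positivity)]
    exact c.φ_antilip (c.U_le (hTb hq)) (c.U_le (hTb hq'))
  have h5 : μH[d] (c.π '' c.FF K T) ≤ A3 * μH[d] (c.FF K T) := by
    apply hausdorff_lip hd
    intro x _ y _
    rw [dist_eq_norm, dist_eq_norm, ← map_sub]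
    simpa using c.π_le (x - y)
  have h6 : μH[d] (c.FF K T) ≤ A4 * μH[d] (c.π '' c.FF K T) := by
    apply hausdorff_antilip hd
    intro x hx y hy
    rw [Real.coe_toNNReal _ (by positivity)]
    exact c.FF_antilip hKc hTb x hx y hy
  constructor
  · calc _ ≤ A3 * (B1 * (A1 * μH[d] T)) := h5.trans (by gcongr; exact h1.trans (by gcongr))
      _ = A3 * (B1 * A1) * μH[d] T := by ring
      _ ≤ _ := by gcongr; exact le_self_add
  · have h7 : μH[d] (c.φ '' T) ≤ B2⁻¹ * μH[d] (c.FF K T) := by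
      calc μH[d] (c.φ '' T) = B2⁻¹ * (B2 * μH[d] (c.φ '' T)) := by
            rw [← mul_assoc, ENNReal.inv_mul_cancel hB2 ENNReal.ofReal_ne_top, one_mul]
        _ ≤ _ := by gcongr
    calc _ ≤ A2 * (B2⁻¹ * (A4 * μH[d] (c.π '' c.FF K T))) :=
          h4.trans (by gcongr; exact h7.trans (by gcongr))
      _ = A2 * (B2⁻¹ * A4) * μH[d] (c.π '' c.FF K T) := by ring
      _ ≤ _ := by gcongr; exact le_add_self

end Chart

namespace Chart
open scoped Pointwise
variable {n : ℕ} {G : Type*} [NormedAddCommGroup G] [InnerProductSpace ℝ G] (c : Chart n G)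

/-- section cut by the point `x'` -/
def sec (K : Set (EuclideanSpace ℝ (Fin n))) (x' : EuclideanSpace ℝ (Fin n)) : Set G :=
  {q | suppFn K (c.U q) ≤ ⟪c.U q, x'⟫}

lemma U_comb (q q' : G) {a b : ℝ} (hab : a + b = 1) :
    c.U (a • q + b • q') = a • c.U q + b • c.U q' := by
  simp only [U, map_add, map_smul, smul_add]
  have : c.u0 = a • c.u0 + b • c.u0 := by rw [← add_smul, hab, one_smul]
  nth_rewrite 1 [this]
  abel

lemma sec_convex {K : Set (EuclideanSpace ℝ (Fin n))} (hK : IsCompact K) (hne : K.Nonempty)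
    (x' : EuclideanSpace ℝ (Fin n)) : Convex ℝ (c.sec K x') := by
  intro q hq q' hq' a b ha hb hab
  simp only [sec, mem_ofPred_eq] at *
  rw [c.U_comb q q' hab, inner_add_left, real_inner_smul_left, real_inner_smul_left]
  refine (supp_comb hK hne _ _ ha hb).trans ?_
  gcongr

lemma sec_closed {K : Set (EuclideanSpace ℝ (Fin n))} (hK : IsCompact K) (hne : K.Nonempty)
    (x' : EuclideanSpace ℝ (Fin n)) : IsClosed (c.sec K x') := by
  apply isClosed_le ((supp_cont hK hne).comp c.U_cont)
  have := c.U_cont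
  fun_prop

lemma sec_interior {K : Set (EuclideanSpace ℝ (Fin n))} (hK : IsCompact K) (hne : K.Nonempty)
    (x' : EuclideanSpace ℝ (Fin n)) {q : G} (hq : suppFn K (c.U q) < ⟪c.U q, x'⟫) :
    q ∈ interior (c.sec K x') := by
  rw [mem_interior]
  refine ⟨{q | suppFn K (c.U q) < ⟪c.U q, x'⟫}, fun q hq => ?_, ?_, hq⟩
  · simp only [sec, mem_ofPred_eq] at *; exact hq.le
  apply isOpen_lt ((supp_cont hK hne).comp c.U_cont)
  have := c.U_cont
  fun_prop

lemma upper_sub {K : Set (EuclideanSpace ℝ (Fin n))} (hK : IsCompact K) (hne : K.Nonempty)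
    (hKc : Convex ℝ K)
    {x' : EuclideanSpace ℝ (Fin n)} {M : ℝ} (hM : 0 < M) (hS : IsCompact (c.sec K x'))
    (h0 : suppFn K c.u0 ≤ ⟪c.u0, x'⟫ - M) {z : G} (hz : z ∈ pol (c.sec K x') 0) :
    c.π x' + (M / 2) • z ∈ c.π '' c.FF K (c.sec K x') := by
  have hU0 : c.U 0 = c.u0 := by simp [U]
  have h0S : (0:G) ∈ c.sec K x' := by
    simp only [sec, mem_ofPred_eq, hU0]; linarith
  let f : G → EuclideanSpace ℝ (Fin n) → ℝ := fun q y => ⟪c.U q, y - x'⟫ - (M / 2) * ⟪z, q⟫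
  have hUc := c.U_cont
  have hSc := c.sec_convex hK hne x'
  obtain ⟨q, hq, y, hy, hsad⟩ := Sion.exists_isSaddlePointOn (f := f) ⟨0, h0S⟩ hSc hS
    (fun y _ => by
      apply LowerSemicontinuous.lowerSemicontinuousOn; apply Continuous.lowerSemicontinuous; simp only [f]; fun_prop)
    (fun y _ => by
      apply ConvexOn.quasiconvexOn
      refine ⟨hSc, fun q1 _ q2 _ a b ha hb hab => le_of_eq ?_⟩
      simp only [f, c.U_comb q1 q2 hab, inner_add_left, real_inner_smul_left, inner_add_right,
        inner_smul_right, smul_eq_mul]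
      ring)
    hKc hne hK
    (fun q _ => by
      apply UpperSemicontinuous.upperSemicontinuousOn; apply Continuous.upperSemicontinuous; simp only [f]; fun_prop)
    (fun q _ => by
      apply ConcaveOn.quasiconcaveOn
      refine ⟨hKc, fun y1 _ y2 _ a b ha hb hab => le_of_eq ?_⟩
      simp only [f, inner_sub_right, inner_add_right,
        inner_smul_right, smul_eq_mul]
      linear_combination (-(⟪c.U q, x'⟫ + M / 2 * ⟪z, q⟫)) * hab)
  have hyf : ⟪c.U q, y⟫ = suppFn K (c.U q) := by
    apply le_antisymm (supp_le hK _ hy)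
    obtain ⟨y', hy', h⟩ := supp_exists hK hne (c.U q)
    have := hsad q hq y' hy'
    simp only [f, inner_sub_right] at this
    linarith
  have hint : suppFn K (c.U q) < ⟪c.U q, x'⟫ := by
    have h1 := hsad 0 h0S y hy
    have h2 := hz q hq
    have h3 := supp_le hK c.u0 hy
    simp only [f, inner_sub_right, hU0, inner_zero_right] at h1
    rw [sub_zero] at h2
    nlinarith
  have hint' := c.sec_interior hK hne x' hint
  set g : G := c.π (y - x') - (M / 2) • z with hg
  have hfg : ∀ q', f q' y = ⟪c.u0, y - x'⟫ + ⟪g, q'⟫ := by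
    intro q'
    simp only [f]
    rw [c.inner_U, hg, inner_sub_left, real_inner_smul_left]; ring
  have hg0 : g = 0 := by
    by_contra hgne
    have hgp : 0 < ‖g‖ := norm_pos_iff.2 hgne
    obtain ⟨r, hr, hball⟩ := Metric.isOpen_iff.1 isOpen_interior q hint'
    have hm : q - (r / 2 / ‖g‖) • g ∈ c.sec K x' := by
      apply interior_subset; apply hball
      rw [Metric.mem_ball, dist_eq_norm]
      simp only [sub_sub_cancel_left, norm_neg, norm_smul]
      rw [Real.norm_of_nonneg (by positivity)]
      field_simp; linarith
    have := hsad _ hm y hy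
    rw [hfg, hfg, inner_sub_right g, inner_smul_right, real_inner_self_eq_norm_sq] at this
    have : 0 < r / 2 / ‖g‖ * ‖g‖ ^ 2 := by positivity
    linarith
  refine ⟨y, ?_, ?_⟩
  · simp only [FF, mem_iUnion]
    exact ⟨q, hq, hy, by rw [real_inner_comm]; exact hyf⟩
  · rw [hg, map_sub] at hg0
    have := sub_eq_zero.1 hg0
    rw [← this]; abel

lemma lower_sub {K : Set (EuclideanSpace ℝ (Fin n))} (hK : IsCompact K) (hne : K.Nonempty)
    {x' : EuclideanSpace ℝ (Fin n)} {M : ℝ} (hM : 0 < M)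
    (hmin : ∀ q ∈ c.sec K x', ⟪c.U q, x'⟫ - 2 * M ≤ suppFn K (c.U q)) {s : G}
    (hs : s ∈ c.sec K x') :
    c.π '' c.FF K (((1:ℝ)/2) • s +ᵥ ((1:ℝ)/2) • c.sec K x') ⊆
      c.π x' +ᵥ (4 * M) • pol (c.sec K x') s := by
  have hSc := c.sec_convex hK hne x'
  rintro _ ⟨y, hy, rfl⟩
  simp only [FF, mem_iUnion] at hy
  obtain ⟨_, ⟨_, ⟨q, hq, rfl⟩, rfl⟩, hyK, hyf⟩ := hy
  simp only [vadd_eq_add] at hyf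
  set q' : G := (1 / 2 : ℝ) • s + (1 / 2 : ℝ) • q with hq'
  have hq'S : q' ∈ c.sec K x' := hSc hs hq (by norm_num) (by norm_num) (by norm_num)
  refine ⟨c.π y - c.π x', ⟨(4 * M)⁻¹ • (c.π y - c.π x'), ?_, ?_⟩, ?_⟩
  · intro q'' hq''
    have hm : (1 / 2 : ℝ) • q + (1 / 2 : ℝ) • q'' ∈ c.sec K x' :=
      hSc hq hq'' (by norm_num) (by norm_num) (by norm_num)
    set q3 := (1 / 2 : ℝ) • q + (1 / 2 : ℝ) • q'' with hq3
    have h1 := supp_le hK (c.U q3) hyK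
    have h2 : suppFn K (c.U q3) ≤ ⟪c.U q3, x'⟫ := hm
    have h3 := hmin q' hq'S
    rw [← hyf, real_inner_comm (c.U q') y] at h3
    have h5 : ⟪c.π y - c.π x', q3 - q'⟫ ≤ 2 * M := by
      rw [← map_sub, inner_sub_right]
      have a1 := c.inner_U q3 (y - x')
      have a2 := c.inner_U q' (y - x')
      rw [inner_sub_right] at a1 a2
      linarith
    have h6 : q3 - q' = (1 / 2 : ℝ) • (q'' - s) := by
      rw [hq3, hq']; module
    rw [h6, inner_smul_right] at h5
    rw [real_inner_smul_left, inv_mul_le_iff₀ (by positivity)]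
    linarith
  · simp only [smul_smul]
    rw [mul_inv_cancel₀ (by positivity), one_smul]
  · simp

variable [FiniteDimensional ℝ G] [MeasurableSpace G] [BorelSpace G]

theorem sec_main (hn : 2 ≤ n) (hfr : (Module.finrank ℝ G : ℝ) = (n:ℝ) - 1)
    {p : ℝ} {τ1 τ2 : ℝ}
    (hτ1 : 0 < τ1) (hτ12 : τ1 < τ2) {f : EuclideanSpace ℝ (Fin n) → ℝ}
    (hf : ∀ u ∈ unitSphere n, τ1 < f u ∧ f u < τ2)
    {K : Set (EuclideanSpace ℝ (Fin n))} (hK : IsConvexBody0 K)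
    (hsol : IsLpSolution p f K) {ρ : ℝ} (hρ : 0 < ρ)
    (hpos : ∀ q ∈ Metric.closedBall (0:G) ρ, 0 < suppFn K (c.U q)) :
    ∃ B : ℝ, 0 < B ∧ ∀ (x' : EuclideanSpace ℝ (Fin n)) (M η : ℝ) (d q1 : G), 0 < M →
      c.sec K x' ⊆ Metric.closedBall 0 ρ → suppFn K c.u0 ≤ ⟪c.u0, x'⟫ - M →
      (∀ q ∈ c.sec K x', ⟪c.U q, x'⟫ - 2 * M ≤ suppFn K (c.U q)) → 0 < η →
      (∀ q ∈ c.sec K x', ⟪d, q⟫ ≤ η) → q1 ∈ c.sec K x' → -⟪d, q1⟫ ≤ B * η := by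
  obtain ⟨C, hC, hcmp⟩ := c.meas_cmp hn hτ1 hτ12 hf hK hsol hρ hpos
  obtain ⟨hKc, hKconv, hKint, h0K⟩ := hK
  have hne : K.Nonempty := ⟨0, h0K⟩
  rw [← hfr] at hcmp
  set m := Module.finrank ℝ G with hm
  set a : ℝ≥0∞ := ENNReal.ofReal ((1 / (2 * ((m : ℝ) + 2))) ^ m) with ha
  have ha0 : a ≠ 0 := by
    simp only [a, ne_eq, ENNReal.ofReal_eq_zero, not_le]; positivity
  obtain ⟨N, hN⟩ := ENNReal.exists_nat_gt
    (r := C * C * ENNReal.ofReal (16 ^ m) / a) (by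
      apply ENNReal.div_ne_top _ ha0
      exact ENNReal.mul_ne_top (ENNReal.mul_ne_top hC hC) ENNReal.ofReal_ne_top)
  have hN0 : 0 < N := by
    rcases Nat.eq_zero_or_pos N with h | h
    · subst h; simp at hN
    · exact h
  refine ⟨4 * N * ((m : ℝ) + 2) + (m + 1), by positivity, ?_⟩
  intro x' M η d q1 hM hSb h0 hmin hη hd hq1
  by_contra hcon
  push Not at hcon
  have hS : IsCompact (c.sec K x') :=
    (isCompact_closedBall _ _).of_isClosed_subset (c.sec_closed hKc hne x') hSb
  have hSc := c.sec_convex hKc hne x'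
  have hU0 : c.U 0 = c.u0 := by simp [U]
  have h0S : (0:G) ∈ interior (c.sec K x') := by
    apply c.sec_interior hKc hne x'; rw [hU0]; linarith
  obtain ⟨s, hs, hP0, hPt, hPle⟩ := geo_main (μH[(m:ℝ)] : Measure G) hS hSc h0S N hN0
    hη hd hq1 (δ := -⟪d, q1⟫) (by linarith) hcon
  rw [← hm] at hPle
  set P := pol (c.sec K x') s
  set μ : Measure G := μH[(m:ℝ)] with hμ
  have hU : ENNReal.ofReal ((M / 2) ^ m) * μ (pol (c.sec K x') 0) ≤ C * μ (c.sec K x') := by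
    refine le_trans ?_ (hcmp _ hS hSb).1
    have : c.π x' +ᵥ (M / 2) • pol (c.sec K x') 0 ⊆ c.π '' c.FF K (c.sec K x') := by
      rintro _ ⟨_, ⟨z, hz, rfl⟩, rfl⟩
      exact c.upper_sub hKc hne hKconv hM hS h0 hz
    refine le_trans (le_of_eq ?_) (measure_mono this)
    rw [measure_vadd, Measure.addHaar_smul, ← hm, abs_of_nonneg (by positivity)]
  have hL : ENNReal.ofReal ((1 / 2) ^ m) * μ (c.sec K x')
      ≤ C * (ENNReal.ofReal ((4 * M) ^ m) * μ P) := by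
    set T : Set G := ((1:ℝ)/2) • s +ᵥ ((1:ℝ)/2) • c.sec K x' with hT
    have hTS : T ⊆ c.sec K x' := by
      rintro _ ⟨_, ⟨z, hz, rfl⟩, rfl⟩
      exact hSc hs hz (by norm_num) (by norm_num) (by norm_num)
    have hTc : IsCompact T := (hS.smul _).vadd _
    have h1 := (hcmp T hTc (hTS.trans hSb)).2
    have h2 : μ T = ENNReal.ofReal ((1 / 2) ^ m) * μ (c.sec K x') := by
      rw [hT, measure_vadd, Measure.addHaar_smul, ← hm, abs_of_nonneg (by positivity)]
    rw [h2] at h1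
    refine h1.trans ?_
    gcongr
    refine (measure_mono (c.lower_sub hKc hne hM hmin hs)).trans (le_of_eq ?_)
    rw [measure_vadd, Measure.addHaar_smul, ← hm, abs_of_nonneg (by positivity)]
  set b1 := ENNReal.ofReal ((M / 2) ^ m) with hb1
  set b2 := ENNReal.ofReal ((1 / 2) ^ m) with hb2
  set b3 := ENNReal.ofReal (16 ^ m) with hb3
  have hb : ENNReal.ofReal ((4 * M) ^ m) = b1 * b2 * b3 := by
    rw [hb1, hb2, hb3, ← ENNReal.ofReal_mul (by positivity), ← ENNReal.ofReal_mul (by positivity),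
      ← mul_pow, ← mul_pow]
    congr 2; ring
  rw [hb] at hL
  have hb10 : b1 ≠ 0 := by simp only [b1, ne_eq, ENNReal.ofReal_eq_zero, not_le]; positivity
  have hb20 : b2 ≠ 0 := by simp only [b2, ne_eq, ENNReal.ofReal_eq_zero, not_le]; positivity
  have hfinal : (b1 * b2 * μ P) * (N * a) ≤ (b1 * b2 * μ P) * (C * C * b3) := by
    calc (b1 * b2 * μ P) * (N * a) = b2 * (b1 * (N * (a * μ P))) := by ring
      _ ≤ b2 * (b1 * μ (pol (c.sec K x') 0)) := by gcongr
      _ ≤ b2 * (C * μ (c.sec K x')) := by gcongr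
      _ = C * (b2 * μ (c.sec K x')) := by ring
      _ ≤ C * (C * (b1 * b2 * b3 * μ P)) := by gcongr
      _ = _ := by ring
  have hne0 : b1 * b2 * μ P ≠ 0 := mul_ne_zero (mul_ne_zero hb10 hb20) hP0
  have hnet : b1 * b2 * μ P ≠ ∞ := ENNReal.mul_ne_top
    (ENNReal.mul_ne_top ENNReal.ofReal_ne_top ENNReal.ofReal_ne_top) hPt
  rw [ENNReal.mul_le_mul_iff_right hne0 hnet] at hfinal
  rw [ENNReal.div_lt_iff (Or.inl ha0) (Or.inl ENNReal.ofReal_ne_top)] at hN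
  exact absurd hfinal (not_le.2 hN)

end Chart

section MkChart
variable {n : ℕ}

lemma exists_chart (e u0 : EuclideanSpace ℝ (Fin n)) (he : ‖e‖ = 1) (hu0 : ⟪u0, e⟫ = 1) :
    ∃ c : Chart n ((ℝ ∙ e)ᗮ : Submodule ℝ (EuclideanSpace ℝ (Fin n))), c.e = e ∧ c.u0 = u0 ∧
      ((Module.finrank ℝ ((ℝ ∙ e)ᗮ : Submodule ℝ (EuclideanSpace ℝ (Fin n))) : ℕ) : ℝ)
        = (n : ℝ) - 1 := by
  refine ⟨{ ι := ((ℝ ∙ e)ᗮ).subtypeₗᵢ, π := ((ℝ ∙ e)ᗮ).orthogonalProjectionOnto, e := e, u0 := u0,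
            he := he, hu0 := hu0, hιe := ?_, hπ := ?_, hdec := ?_ }, rfl, rfl, ?_⟩
  · intro g
    have := (Submodule.mem_orthogonal_singleton_iff_inner_left (𝕜 := ℝ)).1 g.2
    simpa using this
  · intro y g
    rw [real_inner_comm, real_inner_comm _ y]
    simp
  · intro y
    have h1 := Submodule.starProjection_unit_singleton ℝ he y
    have h2 := Submodule.starProjection_orthogonal_val (K := (ℝ ∙ e)) y
    change y = (ℝ ∙ e)ᗮ.starProjection y + ⟪y, e⟫ • e
    rw [h2, h1, real_inner_comm]
    simp
  · have h1 := Submodule.finrank_add_finrank_orthogonal (ℝ ∙ e)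
    rw [finrank_span_singleton (by rintro rfl; simp at he), finrank_euclideanSpace_fin] at h1
    have h2 : (1:ℝ) + (Module.finrank ℝ ((ℝ ∙ e)ᗮ : Submodule ℝ (EuclideanSpace ℝ (Fin n))) : ℕ)
        = n := by exact_mod_cast h1
    linarith

end MkChart

namespace Chart
variable {n : ℕ} {G : Type*} [NormedAddCommGroup G] [InnerProductSpace ℝ G] (c : Chart n G)

/-- the cutting point -/
def xp (x : EuclideanSpace ℝ (Fin n)) (d : G) (δ ε : ℝ) : EuclideanSpace ℝ (Fin n) :=
  x + ε • c.ι d + (ε * δ - ε * ⟪c.u0, c.ι d⟫) • c.e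

lemma inner_xp (x : EuclideanSpace ℝ (Fin n)) (d : G) (δ ε : ℝ) (q : G) :
    ⟪c.U q, c.xp x d δ ε⟫ = ⟪c.U q, x⟫ + ε * (⟪d, q⟫ + δ) := by
  rw [xp, inner_add_right, inner_add_right, inner_smul_right, inner_smul_right, c.U_e]
  have : ⟪c.U q, c.ι d⟫ = ⟪c.u0, c.ι d⟫ + ⟪d, q⟫ := by
    rw [U, inner_add_left, c.ι.inner_map_map, real_inner_comm d q]
  rw [this]; ring

variable [FiniteDimensional ℝ G]

lemma shrink {K : Set (EuclideanSpace ℝ (Fin n))} (hK : IsCompact K) (hne : K.Nonempty)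
    {x : EuclideanSpace ℝ (Fin n)} (hx : x ∈ K) (hux : c.u0 ∈ normalCone K x) (d : G) {δ ρ : ℝ}
    (hδ : 0 < δ) (hρ : 0 < ρ) {O : Set G} (hO : IsOpen O) (hOb : O ⊆ Metric.ball 0 ρ)
    (hyp : ∀ q ∈ Metric.closedBall (0:G) ρ, c.U q ∈ normalCone K x → -δ ≤ ⟪d, q⟫ → q ∈ O) :
    ∃ ε0 : ℝ, 0 < ε0 ∧ ∀ ε, 0 < ε → ε < ε0 → c.sec K (c.xp x d δ ε) ⊆ O := by
  set v : G → ℝ := fun q => suppFn K (c.U q) - ⟪c.U q, x⟫ with hv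
  have hv0 : ∀ q, 0 ≤ v q := fun q => sub_nonneg.2 (supp_le hK _ hx)
  have hUc := c.U_cont
  have hvc : Continuous v := ((supp_cont hK hne).comp hUc).sub (by fun_prop)
  have hU0 : c.U 0 = c.u0 := by simp [U]
  set T : Set G := (Metric.closedBall 0 ρ \ O) ∩ {q | -δ ≤ ⟪d, q⟫} with hT
  have hTc : IsCompact T := ((isCompact_closedBall _ _).diff hO).inter_right
    (isClosed_le continuous_const (by fun_prop))
  obtain ⟨m0, hm0, hTm⟩ : ∃ m0 : ℝ, 0 < m0 ∧ ∀ q ∈ T, m0 ≤ v q := by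
    rcases T.eq_empty_or_nonempty with h | h
    · exact ⟨1, one_pos, by simp [h]⟩
    · obtain ⟨q, hq, hmin⟩ := hTc.exists_isMinOn h hvc.continuousOn
      refine ⟨v q, lt_of_le_of_ne (hv0 q) ?_, fun q' hq' => hmin hq'⟩
      intro h0
      apply hq.1.2
      apply hyp q hq.1.1 _ hq.2
      intro y hy
      have := supp_le hK (c.U q) hy
      simp only [hv] at h0
      linarith
  have hL : 0 < ‖d‖ * ρ + δ := by positivity
  refine ⟨m0 / (‖d‖ * ρ + δ), by positivity, ?_⟩
  intro ε hε hε0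
  rw [lt_div_iff₀ hL] at hε0
  have hmem : ∀ q, q ∈ c.sec K (c.xp x d δ ε) ↔ v q ≤ ε * (⟪d, q⟫ + δ) := by
    intro q
    simp only [sec, mem_ofPred_eq, c.inner_xp, hv]
    constructor <;> intro h <;> linarith
  have key : ∀ q ∈ c.sec K (c.xp x d δ ε), q ∈ Metric.closedBall (0:G) ρ → q ∈ O := by
    intro q hq hqb
    rw [hmem] at hq
    by_contra hqO
    have h1 : 0 ≤ ⟪d, q⟫ + δ := by
      have := (hv0 q).trans hq
      exact nonneg_of_mul_nonneg_right this hε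
    have h2 := hTm q ⟨⟨hqb, hqO⟩, by simp only [mem_ofPred_eq]; linarith⟩
    have h3 := real_inner_le_norm d q
    rw [mem_closedBall_zero_iff] at hqb
    have h4 : ‖d‖ * ‖q‖ ≤ ‖d‖ * ρ := by gcongr
    have h5 : ε * (⟪d, q⟫ + δ) ≤ ε * (‖d‖ * ρ + δ) := by gcongr; linarith
    linarith
  intro q hq
  by_cases hqb : q ∈ Metric.closedBall (0:G) ρ
  · exact key q hq hqb
  exfalso
  rw [mem_closedBall_zero_iff, not_le] at hqb
  have hqn : 0 < ‖q‖ := hρ.trans hqb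
  have h0 : (0:G) ∈ c.sec K (c.xp x d δ ε) := by
    rw [hmem]
    have : v 0 = 0 := by
      apply le_antisymm _ (hv0 0)
      obtain ⟨y, hy, h⟩ := supp_exists hK hne c.u0
      have := hux y hy
      simp only [hv, hU0]; linarith
    rw [this, inner_zero_right]; positivity
  have h1 : (ρ / ‖q‖) • q ∈ c.sec K (c.xp x d δ ε) := by
    have := c.sec_convex hK hne (c.xp x d δ ε) hq h0 (a := ρ / ‖q‖) (b := 1 - ρ / ‖q‖)
      (by positivity) (by rw [sub_nonneg, div_le_one hqn]; exact hqb.le) (by ring)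
    simpa using this
  have hnorm : ‖(ρ / ‖q‖) • q‖ = ρ := by
    rw [norm_smul, Real.norm_of_nonneg (by positivity)]; field_simp
  have h2 := hOb (key _ h1 (by rw [mem_closedBall_zero_iff, hnorm]))
  rw [mem_ball_zero_iff, hnorm] at h2
  exact lt_irrefl _ h2

lemma exists_rho {K : Set (EuclideanSpace ℝ (Fin n))} (hK : IsCompact K) (hne : K.Nonempty)
    (h : 0 < suppFn K c.u0) :
    ∃ ρ : ℝ, 0 < ρ ∧ ∀ q ∈ Metric.closedBall (0:G) ρ, 0 < suppFn K (c.U q) := by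
  have hU0 : c.U 0 = c.u0 := by simp [U]
  have hop : IsOpen {q : G | 0 < suppFn K (c.U q)} :=
    isOpen_lt continuous_const ((supp_cont hK hne).comp c.U_cont)
  obtain ⟨r, hr, hb⟩ := Metric.isOpen_iff.1 hop 0 (by simpa [hU0] using h)
  refine ⟨r / 2, by positivity, fun q hq => hb ?_⟩
  rw [mem_closedBall_zero_iff] at hq
  rw [mem_ball_zero_iff]; linarith

end Chart

section Final
variable {n : ℕ}

lemma ncone_supp {K : Set (EuclideanSpace ℝ (Fin n))} (hK : IsCompact K) (hne : K.Nonempty)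
    {x u : EuclideanSpace ℝ (Fin n)} (hx : x ∈ K) (hu : u ∈ normalCone K x) :
    suppFn K u = ⟪u, x⟫ := by
  obtain ⟨y, hy, h⟩ := supp_exists hK hne u
  exact le_antisymm (h ▸ hu y hy) (supp_le hK u hx)

lemma ncone_comb {K : Set (EuclideanSpace ℝ (Fin n))} {x u v : EuclideanSpace ℝ (Fin n)}
    (hu : u ∈ normalCone K x) (hv : v ∈ normalCone K x) {a b : ℝ} (ha : 0 ≤ a) (hb : 0 ≤ b) :
    a • u + b • v ∈ normalCone K x := by
  intro y hy
  simp only [inner_add_left, real_inner_smul_left]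
  have h1 := mul_le_mul_of_nonneg_left (hu y hy) ha
  have h2 := mul_le_mul_of_nonneg_left (hv y hy) hb
  linarith

lemma ncone_smul {K : Set (EuclideanSpace ℝ (Fin n))} {x u : EuclideanSpace ℝ (Fin n)}
    (hu : u ∈ normalCone K x) {a : ℝ} (ha : 0 ≤ a) : a • u ∈ normalCone K x := by
  have := ncone_comb hu hu ha le_rfl
  simpa using this

lemma thmA_core (hn : 2 ≤ n) {p τ1 τ2 : ℝ} (hτ1 : 0 < τ1) (hτ12 : τ1 < τ2)
    {f : EuclideanSpace ℝ (Fin n) → ℝ} (hf : ∀ u ∈ unitSphere n, τ1 < f u ∧ f u < τ2)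
    {K : Set (EuclideanSpace ℝ (Fin n))} (hK : IsConvexBody0 K) (hsol : IsLpSolution p f K)
    {G : Type*} [NormedAddCommGroup G] [InnerProductSpace ℝ G] [FiniteDimensional ℝ G]
    [MeasurableSpace G] [BorelSpace G] (c : Chart n G)
    (hfr : (Module.finrank ℝ G : ℝ) = (n:ℝ) - 1)
    {x u1 dd : EuclideanSpace ℝ (Fin n)} (hx : x ∈ K)
    (hu1e : ⟪u1, c.e⟫ = 1) (hu0 : c.u0 ∈ normalCone K x)
    (hu1 : u1 ∈ normalCone K x) (hne01 : u1 ≠ c.u0) (hpos0 : 0 < ⟪c.u0, x⟫)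
    (hdd : ∀ w ∈ normalCone K x, ⟪w, c.e⟫ = 1 → 2 * ⟪dd, w - c.u0⟫ ≤ -‖w - c.u0‖ ^ 2) :
    False := by
  have hKc := hK.1
  have hne : K.Nonempty := ⟨x, hx⟩
  obtain ⟨ρ, hρ, hpos⟩ := c.exists_rho hKc hne (by rw [ncone_supp hKc hne hx hu0]; exact hpos0)
  obtain ⟨B, hB, hmain⟩ := c.sec_main hn hfr hτ1 hτ12 hf hK hsol hρ hpos
  set d := c.π dd with hd
  have hUs : ∀ q, c.U q - c.u0 = c.ι q := fun q => by simp [Chart.U]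
  have hdq : ∀ q, c.U q ∈ normalCone K x → ⟪d, q⟫ ≤ -‖q‖ ^ 2 / 2 := by
    intro q hq
    have := hdd _ hq (c.U_e q)
    rw [hUs, c.ι.norm_map, ← c.hπ] at this
    linarith
  set q1 := c.π (u1 - c.u0) with hq1
  have hιq1 : c.ι q1 = u1 - c.u0 := by
    have := c.hdec (u1 - c.u0)
    rw [inner_sub_left, hu1e, c.hu0, sub_self, zero_smul, add_zero] at this
    exact this.symm
  have hq1n : 0 < ‖q1‖ := by
    rw [← c.ι.norm_map, hιq1, norm_pos_iff, sub_ne_zero]; exact hne01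
  have hUq1 : c.U q1 = u1 := by simp [Chart.U, hιq1]
  have hdq1 : ⟪d, q1⟫ < 0 := by
    have := hdq q1 (hUq1 ▸ hu1)
    have : 0 < ‖q1‖ ^ 2 := by positivity
    linarith
  obtain ⟨l, hl0, hl1, hlρ⟩ : ∃ l : ℝ, 0 < l ∧ l ≤ 1 ∧ 2 * (l * -⟪d, q1⟫) < ρ ^ 2 := by
    refine ⟨min 1 (ρ ^ 2 / (4 * -⟪d, q1⟫)), ?_, min_le_left _ _, ?_⟩
    · have : 0 < -⟪d, q1⟫ := by linarith
      positivity
    · have h0 : 0 < -⟪d, q1⟫ := by linarith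
      have h1 := min_le_right 1 (ρ ^ 2 / (4 * -⟪d, q1⟫))
      rw [le_div_iff₀ (by positivity)] at h1
      have : 0 < ρ ^ 2 := by positivity
      linarith
  set q2 := l • q1 with hq2
  set δ := l * -⟪d, q1⟫ with hδ
  have hδ0 : 0 < δ := mul_pos hl0 (by linarith)
  have hdq2 : ⟪d, q2⟫ = -δ := by rw [hq2, inner_smul_right, hδ]; ring
  have hUq2 : c.U q2 ∈ normalCone K x := by
    have h := ncone_comb hu1 hu0 hl0.le (sub_nonneg.2 hl1)
    have : c.U q2 = l • u1 + (1 - l) • c.u0 := by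
      rw [Chart.U, hq2, map_smul, hιq1]; module
    rw [this]; exact h
  set η := δ / (B + 1) with hη
  have hη0 : 0 < η := by positivity
  have hηδ : η ≤ δ := by
    rw [hη]; exact div_le_self hδ0.le (by linarith)
  obtain ⟨ε0, hε0, hsh⟩ := c.shrink hKc hne hx hu0 d hδ0 hρ
    (O := Metric.ball 0 ρ ∩ {q | ⟪d, q⟫ < η})
    (Metric.isOpen_ball.inter (isOpen_lt (by fun_prop) continuous_const)) inter_subset_left (by
      intro q _ hqN hqδ
      have h1 := hdq q hqN
      refine ⟨?_, ?_⟩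
      · rw [mem_ball_zero_iff]
        have : ‖q‖ ^ 2 < ρ ^ 2 := by linarith
        exact lt_of_pow_lt_pow_left₀ 2 hρ.le this
      · have : 0 ≤ ‖q‖ ^ 2 := by positivity
        simp only [mem_ofPred_eq]; linarith)
  have hs := hsh (ε0 / 2) (by positivity) (by linarith)
  set ε := ε0 / 2 with hε
  have hεp : 0 < ε := by positivity
  have hfin := hmain (c.xp x d δ ε) (ε * δ) η d q2 (by positivity)
    (fun q hq => Metric.ball_subset_closedBall (hs hq).1) (by
      have := c.inner_xp x d δ ε 0
      have hU0 : c.U 0 = c.u0 := by simp [Chart.U]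
      rw [hU0, inner_zero_right, zero_add] at this
      rw [this, ncone_supp hKc hne hx hu0]; linarith) (by
      intro q hq
      rw [c.inner_xp]
      have h1 := supp_le hKc (c.U q) hx
      have h2 : ⟪d, q⟫ < η := (hs hq).2
      have h3 : ε * ⟪d, q⟫ ≤ ε * δ := by gcongr; linarith
      linarith) hη0 (fun q hq => le_of_lt (hs hq).2) (by
      simp only [Chart.sec, mem_ofPred_eq]
      rw [c.inner_xp, hdq2, ncone_supp hKc hne hx hUq2]; linarith)
  rw [hdq2, hη, neg_neg, mul_div_assoc', le_div_iff₀ (by positivity)] at hfin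
  linarith

theorem thmA (hn : 2 ≤ n) {p τ1 τ2 : ℝ} (hτ1 : 0 < τ1) (hτ12 : τ1 < τ2)
    {f : EuclideanSpace ℝ (Fin n) → ℝ} (hf : ∀ u ∈ unitSphere n, τ1 < f u ∧ f u < τ2)
    {K : Set (EuclideanSpace ℝ (Fin n))} (hK : IsConvexBody0 K) (hsol : IsLpSolution p f K)
    {x u u' : EuclideanSpace ℝ (Fin n)} (hx : x ∈ K) (hu : u ∈ normalCone K x)
    (hu0 : u ∉ normalCone K 0) (hu' : u' ∈ normalCone K x) : ∃ t : ℝ, 0 ≤ t ∧ u' = t • u := by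
  by_contra hcon
  have hKc := hK.1
  have hne : K.Nonempty := ⟨x, hx⟩
  obtain ⟨k0, hk0⟩ := hK.2.2.1
  obtain ⟨r, hr, hball⟩ := Metric.isOpen_iff.1 isOpen_interior k0 hk0
  have hlow : ∀ w ∈ normalCone K x, r / 2 * ‖w‖ ≤ ⟪w, x - k0⟫ := by
    intro w hw
    rcases eq_or_ne w 0 with rfl | h0
    · simp
    have hwn : 0 < ‖w‖ := norm_pos_iff.2 h0
    have hm : k0 + (r / 2 / ‖w‖) • w ∈ K := by
      apply interior_subset (hball _)
      rw [Metric.mem_ball, dist_eq_norm, add_sub_cancel_left, norm_smul,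
        Real.norm_of_nonneg (by positivity), div_mul_cancel₀ _ hwn.ne']
      linarith
    have := hw _ hm
    rw [inner_add_right, inner_smul_right, real_inner_self_eq_norm_sq] at this
    rw [inner_sub_right]
    have h2 : r / 2 / ‖w‖ * ‖w‖ ^ 2 = r / 2 * ‖w‖ := by field_simp
    linarith
  have hun : u ≠ 0 := by
    rintro rfl; apply hu0; intro y _; simp
  have hun' : u' ≠ 0 := by
    rintro rfl; exact hcon ⟨0, le_rfl, by simp⟩
  have hxk : 0 < ‖x - k0‖ := by
    rw [norm_pos_iff]; intro h
    have := hlow u hu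
    rw [h, inner_zero_right] at this
    have : 0 < ‖u‖ := norm_pos_iff.2 hun
    nlinarith
  set e := ‖x - k0‖⁻¹ • (x - k0) with he
  have hen : ‖e‖ = 1 := by
    rw [he, norm_smul, norm_inv, norm_norm, inv_mul_cancel₀ hxk.ne']
  set s := r / 2 / ‖x - k0‖ with hs
  have hs0 : 0 < s := by positivity
  have hlow2 : ∀ w ∈ normalCone K x, s * ‖w‖ ≤ ⟪w, e⟫ := by
    intro w hw
    rw [he, inner_smul_right, hs]
    have := hlow w hw
    rw [div_mul_eq_mul_div, div_eq_inv_mul]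
    gcongr
  have hue : 0 < ⟪u, e⟫ := lt_of_lt_of_le (mul_pos hs0 (norm_pos_iff.2 hun)) (hlow2 u hu)
  have hue' : 0 < ⟪u', e⟫ := lt_of_lt_of_le (mul_pos hs0 (norm_pos_iff.2 hun')) (hlow2 u' hu')
  set W : Set (EuclideanSpace ℝ (Fin n)) := normalCone K x ∩ {w | ⟪w, e⟫ = 1} with hW
  have hNclosed : IsClosed (normalCone K x) := by
    have : normalCone K x = ⋂ y ∈ K, {u | ⟪u, y⟫ ≤ ⟪u, x⟫} := by
      ext w; simp [normalCone]
    rw [this]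
    exact isClosed_biInter fun y _ => isClosed_le (by fun_prop) (by fun_prop)
  have hWc : IsCompact W := by
    apply Metric.isCompact_of_isClosed_isBounded
    · exact hNclosed.inter (isClosed_eq (by fun_prop) continuous_const)
    · rw [isBounded_iff_forall_norm_le]
      refine ⟨1 / s, fun w hw => ?_⟩
      have := hlow2 w hw.1
      rw [hw.2] at this
      rw [le_div_iff₀ hs0]; linarith
  set b := ⟪u, e⟫⁻¹ • u with hb
  set b' := ⟪u', e⟫⁻¹ • u' with hb'
  have hbW : b ∈ W := ⟨ncone_smul hu (by positivity), by
    simp only [mem_ofPred_eq, hb, real_inner_smul_left]; field_simp⟩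
  have hbW' : b' ∈ W := ⟨ncone_smul hu' (by positivity), by
    simp only [mem_ofPred_eq, hb', real_inner_smul_left]; field_simp⟩
  have hbb : b ≠ b' := by
    intro h
    apply hcon
    refine ⟨⟪u', e⟫ * ⟪u, e⟫⁻¹, by positivity, ?_⟩
    rw [mul_smul, ← hb, h, hb', smul_smul, mul_inv_cancel₀ hue'.ne', one_smul]
  have hux : 0 < ⟪u, x⟫ := by
    by_contra h
    apply hu0
    intro y hy
    rw [inner_zero_right]
    exact (hu y hy).trans (not_lt.1 h)
  have hbx : 0 < ⟪b, x⟫ := by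
    rw [hb, real_inner_smul_left]; positivity
  obtain ⟨R, hR⟩ := hWc.isBounded.exists_norm_le
  set D := 2 * R with hD
  have hDb : ∀ w ∈ W, ‖w - b‖ ≤ D := by
    intro w hw
    have := norm_sub_le w b
    have := hR w hw
    have := hR b hbW
    linarith
  set t := (D ^ 2 + 1) / (2 * ⟪b, x⟫) with ht
  have htb : 2 * t * ⟪b, x⟫ = D ^ 2 + 1 := by rw [ht]; field_simp
  have ht0 : 0 < t := by positivity
  set c0 := b - t • x with hc0
  obtain ⟨u0, hu0W, hmax⟩ := hWc.exists_isMaxOn ⟨b, hbW⟩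
    (f := fun w => ‖w - c0‖) (by fun_prop)
  have hmax' : ∀ w ∈ W, ‖w - c0‖ ^ 2 ≤ ‖u0 - c0‖ ^ 2 := fun w hw => by
    have : ‖w - c0‖ ≤ ‖u0 - c0‖ := hmax hw
    gcongr
  have hpos0 : 0 < ⟪u0, x⟫ := by
    have h1 := hmax' b hbW
    have h2 : u0 - c0 = (u0 - b) + t • x := by rw [hc0]; abel
    have h3 : b - c0 = t • x := by rw [hc0]; abel
    rw [h2, h3, norm_add_sq_real, inner_smul_right, inner_sub_left] at h1
    have h4 := hDb u0 hu0W
    have h5 : ‖u0 - b‖ ^ 2 ≤ D ^ 2 := by gcongr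
    have h6 : 0 < t * ⟪u0, x⟫ := by nlinarith
    exact pos_of_mul_pos_right h6 ht0.le
  obtain ⟨u1, hu1W, hu1⟩ : ∃ u1 ∈ W, u1 ≠ u0 := by
    by_cases h : b = u0
    · exact ⟨b', hbW', fun h' => hbb (h.trans h'.symm)⟩
    · exact ⟨b, hbW, h⟩
  obtain ⟨c, hce, hcu, hfr⟩ := exists_chart e u0 hen hu0W.2
  refine thmA_core hn hτ1 hτ12 hf hK hsol c hfr hx (u1 := u1) (by rw [hce]; exact hu1W.2)
    (by rw [hcu]; exact hu0W.1) hu1W.1 (by rw [hcu]; exact hu1) (by rw [hcu]; exact hpos0)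
    (dd := u0 - c0) ?_
  rw [hce, hcu]
  intro w hw hwe
  have h1 := hmax' w ⟨hw, hwe⟩
  have h2 : w - c0 = (u0 - c0) + (w - u0) := by abel
  rw [h2, norm_add_sq_real] at h1
  linarith

lemma thmB_core (hn : 2 ≤ n) {p τ1 τ2 : ℝ} (hτ1 : 0 < τ1) (hτ12 : τ1 < τ2)
    {f : EuclideanSpace ℝ (Fin n) → ℝ} (hf : ∀ u ∈ unitSphere n, τ1 < f u ∧ f u < τ2)
    {K : Set (EuclideanSpace ℝ (Fin n))} (hK : IsConvexBody0 K) (hsol : IsLpSolution p f K)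
    {G : Type*} [NormedAddCommGroup G] [InnerProductSpace ℝ G] [FiniteDimensional ℝ G]
    [MeasurableSpace G] [BorelSpace G] (c : Chart n G)
    (hfr : (Module.finrank ℝ G : ℝ) = (n:ℝ) - 1)
    {x y1 : EuclideanSpace ℝ (Fin n)} (hx : x ∈ K) (hy1 : y1 ∈ K) (hxy : y1 ≠ x)
    (hce : c.e = c.u0) (hu0 : c.u0 ∈ normalCone K x) (hpos0 : 0 < ⟪c.u0, x⟫)
    (horth : ⟪c.u0, y1 - x⟫ = 0)
    (hex : ∀ y ∈ K, ⟪c.u0, y⟫ = ⟪c.u0, x⟫ → 0 ≤ ⟪y1 - x, y - x⟫)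
    (hA : ∀ w ∈ normalCone K x, ∃ t : ℝ, 0 ≤ t ∧ w = t • c.u0) : False := by
  have hKc := hK.1
  have hne : K.Nonempty := ⟨x, hx⟩
  obtain ⟨ρ, hρ, hpos⟩ := c.exists_rho hKc hne (by rw [ncone_supp hKc hne hx hu0]; exact hpos0)
  obtain ⟨B, hB, hmain⟩ := c.sec_main hn hfr hτ1 hτ12 hf hK hsol hρ hpos
  set dE := y1 - x with hdE
  set d := c.π dE with hd
  have hιd : c.ι d = dE := by
    have := c.hdec dE
    rw [hce, real_inner_comm, horth, zero_smul, add_zero] at this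
    exact this.symm
  have hdn : 0 < ‖d‖ := by
    rw [← c.ι.norm_map, hιd, norm_pos_iff, hdE, sub_ne_zero]; exact hxy
  set κ := ‖d‖ ^ 2 / (2 * B) with hκ
  have hκ0 : 0 < κ := by positivity
  obtain ⟨ε0, hε0, hsh⟩ := c.shrink hKc hne hx hu0 (0:G) one_pos hρ
    (O := Metric.ball 0 ρ) Metric.isOpen_ball subset_rfl (by
      intro q _ hqN _
      obtain ⟨t, ht, h⟩ := hA _ hqN
      have h1 := c.U_e q
      rw [h, real_inner_smul_left, c.hu0, mul_one] at h1
      rw [h1, one_smul, Chart.U, add_eq_left] at h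
      have : ‖q‖ = 0 := by rw [← c.ι.norm_map, h, norm_zero]
      rw [mem_ball_zero_iff, this]; exact hρ)
  obtain ⟨m0, hm0, hbad⟩ : ∃ m0 : ℝ, 0 < m0 ∧ ∀ y ∈ K, κ ≤ ⟪dE, x - y⟫ → m0 ≤ ⟪c.u0, x - y⟫ := by
    have hTc : IsCompact (K ∩ {y | κ ≤ ⟪dE, x - y⟫}) :=
      hKc.inter_right (isClosed_le continuous_const (by fun_prop))
    rcases (K ∩ {y | κ ≤ ⟪dE, x - y⟫}).eq_empty_or_nonempty with h | h
    · refine ⟨1, one_pos, fun y hy hy2 => ?_⟩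
      have : y ∈ (K ∩ {y | κ ≤ ⟪dE, x - y⟫}) := ⟨hy, hy2⟩
      rw [h] at this; exact this.elim
    · obtain ⟨z, hz, hmin⟩ := hTc.exists_isMinOn h
        (f := fun y => ⟪c.u0, x - y⟫) (by fun_prop)
      refine ⟨⟪c.u0, x - z⟫, ?_, fun y hy hy2 => hmin ⟨hy, hy2⟩⟩
      have h1 := hu0 z hz.1
      rw [inner_sub_right]
      rcases h1.lt_or_eq with h2 | h2
      · linarith
      · exfalso
        have h3 := hex z hz.1 h2
        have h4 : κ ≤ ⟪dE, x - z⟫ := hz.2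
        rw [← neg_sub, inner_neg_right] at h4
        linarith
  obtain ⟨L, hL⟩ : ∃ L : ℝ, ∀ y ∈ K, ⟪dE, x - y⟫ ≤ L := by
    obtain ⟨L, hL⟩ := (hKc.image (f := fun y => ⟪dE, x - y⟫) (by fun_prop)).bddAbove
    exact ⟨L, fun y hy => hL ⟨y, hy, rfl⟩⟩
  obtain ⟨t, ht0, htε, htL⟩ : ∃ t : ℝ, 0 < t ∧ κ * t < ε0 ∧ t * L ≤ m0 := by
    refine ⟨min (ε0 / (2 * κ)) (m0 / (|L| + 1)), by positivity, ?_, ?_⟩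
    · have h1 := min_le_left (ε0 / (2 * κ)) (m0 / (|L| + 1))
      rw [le_div_iff₀ (by positivity)] at h1
      linarith
    · have h1 := min_le_right (ε0 / (2 * κ)) (m0 / (|L| + 1))
      rw [le_div_iff₀ (by positivity)] at h1
      have h2 : 0 < min (ε0 / (2 * κ)) (m0 / (|L| + 1)) := by positivity
      have h3 := mul_le_mul_of_nonneg_left (le_abs_self L) h2.le
      linarith
  set ε := κ * t with hε
  have hεp : 0 < ε := by positivity
  have hs := hsh ε hεp htε
  have hxp : ∀ q, ⟪c.U q, c.xp x 0 1 ε⟫ = ⟪c.U q, x⟫ + ε := fun q => by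
    rw [c.inner_xp, inner_zero_left]; ring
  have hfin := hmain (c.xp x 0 1 ε) ε ε d (-(t • d)) hεp
    (fun q hq => Metric.ball_subset_closedBall (hs hq)) (by
      have := hxp 0
      have hU0 : c.U 0 = c.u0 := by simp [Chart.U]
      rw [hU0] at this
      rw [this, ncone_supp hKc hne hx hu0]; linarith) (by
      intro q hq
      rw [hxp]
      have h1 := supp_le hKc (c.U q) hx
      linarith) hεp (by
      intro q hq
      simp only [Chart.sec, mem_ofPred_eq] at hq
      rw [hxp] at hq
      have h1 := supp_le hKc (c.U q) hy1
      have h2 := c.inner_U q dE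
      rw [horth, hdE, inner_sub_right, ← hdE, ← hd] at h2
      linarith) (by
      simp only [Chart.sec, mem_ofPred_eq]
      rw [hxp]
      obtain ⟨y, hy, h⟩ := supp_exists hKc hne (c.U (-(t • d)))
      rw [← h]
      have h2 := c.inner_U (-(t • d)) (x - y)
      rw [c.hπ, map_neg, map_smul, hιd, inner_neg_right, inner_smul_right,
        inner_sub_right (c.U _), real_inner_comm dE (x - y)] at h2
      by_cases hc : κ ≤ ⟪dE, x - y⟫
      · have h3 := hbad y hy hc
        have h4 := mul_le_mul_of_nonneg_left (hL y hy) ht0.le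
        linarith
      · have h3 := hu0 y hy
        have h4 := mul_le_mul_of_nonneg_left (not_le.1 hc).le ht0.le
        have h5 : 0 ≤ ⟪c.u0, x - y⟫ := by rw [inner_sub_right]; linarith
        linarith)
  rw [inner_neg_right, inner_smul_right, real_inner_self_eq_norm_sq, neg_neg, hε, hκ] at hfin
  have h1 : B * (‖d‖ ^ 2 / (2 * B) * t) = t * ‖d‖ ^ 2 / 2 := by field_simp
  have h2 : 0 < t * ‖d‖ ^ 2 := by positivity
  linarith

theorem thmB (hn : 2 ≤ n) {p τ1 τ2 : ℝ} (hτ1 : 0 < τ1) (hτ12 : τ1 < τ2)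
    {f : EuclideanSpace ℝ (Fin n) → ℝ} (hf : ∀ u ∈ unitSphere n, τ1 < f u ∧ f u < τ2)
    {K : Set (EuclideanSpace ℝ (Fin n))} (hK : IsConvexBody0 K) (hsol : IsLpSolution p f K)
    {u y1 y2 : EuclideanSpace ℝ (Fin n)} (hy1 : y1 ∈ K) (hy2 : y2 ∈ K) (hne12 : y1 ≠ y2)
    (hu1 : u ∈ normalCone K y1) (hu2 : u ∈ normalCone K y2) (hu0 : u ∉ normalCone K 0) :
    False := by
  have hKc := hK.1
  have hun : u ≠ 0 := by
    rintro rfl; apply hu0; intro y _; simp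
  have hunp : 0 < ‖u‖ := norm_pos_iff.2 hun
  set e := ‖u‖⁻¹ • u with he
  have hen : ‖e‖ = 1 := by
    rw [he, norm_smul, norm_inv, norm_norm, inv_mul_cancel₀ hunp.ne']
  have he1 : e ∈ normalCone K y1 := ncone_smul hu1 (by positivity)
  have he2 : e ∈ normalCone K y2 := ncone_smul hu2 (by positivity)
  have he0 : e ∉ normalCone K 0 := by
    intro h
    apply hu0
    have := ncone_smul h hunp.le
    rwa [he, smul_smul, mul_inv_cancel₀ hunp.ne', one_smul] at this
  set F : Set (EuclideanSpace ℝ (Fin n)) := K ∩ {y | ⟪e, y⟫ = ⟪e, y1⟫} with hF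
  have hFc : IsCompact F := hKc.inter_right (isClosed_eq (by fun_prop) continuous_const)
  have hy1F : y1 ∈ F := ⟨hy1, rfl⟩
  have hy2F : y2 ∈ F := ⟨hy2, le_antisymm (he1 y2 hy2) (he2 y1 hy1)⟩
  obtain ⟨x, hxF, hmax⟩ := hFc.exists_isMaxOn ⟨y1, hy1F⟩
    (f := fun w => ‖w - y1‖) (by fun_prop)
  have hxy : y1 ≠ x := by
    rintro rfl
    have : ‖y2 - y1‖ ≤ ‖y1 - y1‖ := hmax hy2F
    rw [sub_self, norm_zero] at this
    exact hne12 (sub_eq_zero.1 (norm_le_zero_iff.1 this)).symm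
  have hex1 : e ∈ normalCone K x := by
    intro y hy
    have h : ⟪e, x⟫ = ⟪e, y1⟫ := hxF.2
    rw [h]; exact he1 y hy
  obtain ⟨c, hce, hcu, hfr⟩ := exists_chart e e hen (by
    rw [real_inner_self_eq_norm_sq, hen]; norm_num)
  refine thmB_core hn hτ1 hτ12 hf hK hsol c hfr hxF.1 hy1 hxy (hce.trans hcu.symm) ?_ ?_ ?_ ?_ ?_
  all_goals rw [hcu]
  · exact hex1
  · by_contra h
    apply he0
    intro y hy
    rw [inner_zero_right]
    exact (hex1 y hy).trans (not_lt.1 h)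
  · have h : ⟪e, x⟫ = ⟪e, y1⟫ := hxF.2
    rw [inner_sub_right, h, sub_self]
  · intro y hy h
    have h0 : ⟪e, x⟫ = ⟪e, y1⟫ := hxF.2
    have h1 : ‖y - y1‖ ≤ ‖x - y1‖ := hmax ⟨hy, h.trans h0⟩
    have h2 : ‖y - y1‖ ^ 2 ≤ ‖x - y1‖ ^ 2 := by gcongr
    have h3 : y - y1 = (y - x) - (y1 - x) := by abel
    rw [h3, norm_sub_sq_real, norm_sub_rev x y1, real_inner_comm] at h2
    have : 0 ≤ ‖y - x‖ ^ 2 := by positivity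
    linarith
  · intro w hw
    exact thmA hn hτ1 hτ12 hf hK hsol hxF.1 hex1 he0 hw

lemma exists_normal {K : Set (EuclideanSpace ℝ (Fin n))} (hK : IsConvexBody0 K)
    {x : EuclideanSpace ℝ (Fin n)} (hx : x ∈ frontier K) :
    ∃ u ∈ normalCone K x, ‖u‖ = 1 := by
  obtain ⟨g, hg, hgx⟩ := geometric_hahn_banach_of_nonempty_interior_point hK.2.1 hx.2 hK.2.2.1
  set w := (InnerProductSpace.toDual ℝ (EuclideanSpace ℝ (Fin n))).symm g with hw
  have hwg : ∀ y, ⟪w, y⟫ = g y := fun y => InnerProductSpace.toDual_symm_apply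
  have hwn : w ≠ 0 := by
    intro h
    apply hg
    ext1 y
    rw [← hwg, h, inner_zero_left]; rfl
  have hwN : w ∈ normalCone K x := by
    intro y hy
    rw [hwg, hwg]; exact hgx y hy
  have hp : 0 < ‖w‖ := norm_pos_iff.2 hwn
  refine ⟨‖w‖⁻¹ • w, ncone_smul hwN (by positivity), ?_⟩
  rw [norm_smul, norm_inv, norm_norm, inv_mul_cancel₀ hp.ne']

end Final

/-- **Theorem 1.2 (i) (Caffarelli; Chou–Wang).** The set `X₀` of boundary points whose
normal cone is contained in `N(K,o)` is closed, every point of `∂K \ X₀` is a smooth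
point, and `∂K \ X₀` contains no nondegenerate segment. -/
theorem stmt0 {n : ℕ} (hn : 2 ≤ n) {p : ℝ} (hp : p < 1) {τ1 τ2 : ℝ}
    (hτ1 : 0 < τ1) (hτ12 : τ1 < τ2) {f : EuclideanSpace ℝ (Fin n) → ℝ}
    (hf : ∀ u ∈ unitSphere n, τ1 < f u ∧ f u < τ2)
    {K : Set (EuclideanSpace ℝ (Fin n))} (hK : IsConvexBody0 K)
    (hsol : IsLpSolution p f K)
    (X0 : Set (EuclideanSpace ℝ (Fin n)))
    (hX0 : X0 = {x ∈ frontier K | normalCone K x ⊆ normalCone K 0}) :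
    IsClosed X0 ∧ (∀ x ∈ frontier K \ X0, IsSmoothPt K x) ∧
      ∀ x y : EuclideanSpace ℝ (Fin n), x ≠ y → ¬ segment ℝ x y ⊆ frontier K \ X0 := by
  subst hX0
  have hKc := hK.1
  have hKcl := hKc.isClosed
  have hfK : ∀ x ∈ frontier K, x ∈ K := fun x hx => hKcl.frontier_subset hx
  have hbad : ∀ x ∈ frontier K \ {x ∈ frontier K | normalCone K x ⊆ normalCone K 0},
      ∃ u ∈ normalCone K x, u ∉ normalCone K 0 := by
    intro x hx
    by_contra h
    push Not at h
    exact hx.2 ⟨hx.1, h⟩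
  refine ⟨?_, ?_, ?_⟩
  · apply isClosed_of_closure_subset
    intro x hx
    have hxf : x ∈ frontier K :=
      isClosed_frontier.closure_subset_iff.2 (fun y hy => hy.1) hx
    by_contra hx0
    obtain ⟨v, hv, hv0⟩ := hbad x ⟨hxf, hx0⟩
    obtain ⟨s, hs, hslim⟩ := mem_closure_iff_seq_limit.1 hx
    have hN : ∀ k, ∃ u ∈ normalCone K (s k), ‖u‖ = 1 := fun k => exists_normal hK (hs k).1
    choose w hw hw1 using hN
    obtain ⟨a, ha, φ, hφ, hlim⟩ := (isCompact_sphere (0 : EuclideanSpace ℝ (Fin n)) 1).tendsto_subseq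
      (x := w) (fun k => by rw [mem_sphere_zero_iff_norm]; exact hw1 k)
    rw [mem_sphere_zero_iff_norm] at ha
    have hslim' := hslim.comp hφ.tendsto_atTop
    have hax : a ∈ normalCone K x := by
      intro y hy
      exact le_of_tendsto_of_tendsto' (hlim.inner tendsto_const_nhds) (hlim.inner hslim')
        (fun k => hw (φ k) y hy)
    have ha0 : a ∈ normalCone K 0 := by
      intro y hy
      exact le_of_tendsto_of_tendsto' (hlim.inner tendsto_const_nhds)
        (hlim.inner tendsto_const_nhds) (fun k => (hs (φ k)).2 (hw (φ k)) y hy)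
    obtain ⟨t, ht, hta⟩ := thmA hn hτ1 hτ12 hf hK hsol (hfK x hxf) hv hv0 hax
    have ht0 : t ≠ 0 := by
      rintro rfl
      rw [hta, zero_smul, norm_zero] at ha
      exact zero_ne_one ha
    apply hv0
    have := ncone_smul ha0 (inv_nonneg.2 ht)
    rwa [hta, smul_smul, inv_mul_cancel₀ ht0, one_smul] at this
  · intro x hx
    obtain ⟨v, hv, hv0⟩ := hbad x hx
    have hvn : v ≠ 0 := by
      rintro rfl; apply hv0; intro y _; simp
    have : Submodule.span ℝ (normalCone K x) = Submodule.span ℝ {v} := by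
      apply le_antisymm
      · rw [Submodule.span_le]
        intro w hw
        obtain ⟨t, _, h⟩ := thmA hn hτ1 hτ12 hf hK hsol (hfK x hx.1) hv hv0 hw
        exact Submodule.mem_span_singleton.2 ⟨t, h.symm⟩
      · exact Submodule.span_mono (singleton_subset_iff.2 hv)
    rw [IsSmoothPt, this, finrank_span_singleton hvn]
  · intro x y hxy hseg
    have hxK := hfK x (hseg (left_mem_segment ℝ x y)).1
    have hyK := hfK y (hseg (right_mem_segment ℝ x y)).1
    obtain ⟨u, hu, hu0⟩ := hbad _ (hseg (midpoint_mem_segment x y))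
    have hm : ⟪u, midpoint ℝ x y⟫ = (⟪u, x⟫ + ⟪u, y⟫) / 2 := by
      rw [midpoint_eq_smul_add, inner_smul_right, inner_add_right, invOf_eq_inv]; ring
    have h1 := hu x hxK
    have h2 := hu y hyK
    rw [hm] at h1 h2
    refine thmB hn hτ1 hτ12 hf hK hsol hxK hyK hxy (u := u) ?_ ?_ hu0
    · intro z hz
      have := hu z hz
      rw [hm] at this; linarith
    · intro z hz
      have := hu z hz
      rw [hm] at this; linarith
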